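/- arXiv:1908.04421 — 13 statements merged into one kernel-verified Lean document; each statement's English description precedes it below -/
import Mathlib

section
/- Let Z be a metric space and let X, Y be subsets of Z with Z = X ∪ Y. If there exist a Lipschitz light map X → ℝ^m and a Lipschitz light map Y → ℝ^n (each with respect to the metric induced from Z), then there exists a Lipschitz light map Z → ℝ^{m+n}. In particular, the Lipschitz dimension of Z is at most the sum of the Lipschitz dimensions of X and Y. -/
open Metric Set

/-- `f` is Lipschitz light with constant `C`: `f` is `C`-Lipschitz, and for every `r > 0`
and every `W ⊆ Y` of diameter at most `r`, every `r`-path contained in `f ⁻¹' W`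
has diameter at most `C * r`. -/
def LipschitzLightWith {X Y : Type*} [PseudoMetricSpace X] [PseudoMetricSpace Y]
    (C : ℝ) (f : X → Y) : Prop :=
  (∀ x x', dist (f x) (f x') ≤ C * dist x x') ∧
  ∀ r > 0, ∀ W : Set Y, (∀ w ∈ W, ∀ w' ∈ W, dist w w' ≤ r) →
    ∀ (k : ℕ) (p : ℕ → X), (∀ i ≤ k, f (p i) ∈ W) →
      (∀ i < k, dist (p i) (p (i + 1)) ≤ r) →
      ∀ i ≤ k, ∀ j ≤ k, dist (p i) (p j) ≤ C * r

/-- `f` is Lipschitz light if it is Lipschitz light with some constant `C > 0`. -/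
def LipschitzLight {X Y : Type*} [PseudoMetricSpace X] [PseudoMetricSpace Y]
    (f : X → Y) : Prop :=
  ∃ C > 0, LipschitzLightWith C f

/-- A Lipschitz light map on a subset `X` of `Z` extends to a Lipschitz map `h` on `Z` such that
`r`-paths inside `X` on which `h` oscillates by at most `r` have diameter at most `C * r`. -/
theorem LipschitzLight.exists_extension {Z E : Type*} [MetricSpace Z] [NormedAddCommGroup E]
    [NormedSpace ℝ E] [FiniteDimensional ℝ E] {X : Set Z} {f : X → E} (hf : LipschitzLight f) :
    ∃ (h : Z → E) (K C : ℝ), 0 ≤ K ∧ 0 < C ∧ (∀ z z', dist (h z) (h z') ≤ K * dist z z') ∧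
      ∀ r > 0, ∀ (k : ℕ) (p : ℕ → Z), (∀ i ≤ k, p i ∈ X) →
        (∀ i ≤ k, ∀ j ≤ k, dist (h (p i)) (h (p j)) ≤ r) →
        (∀ i < k, dist (p i) (p (i + 1)) ≤ r) →
        ∀ i ≤ k, ∀ j ≤ k, dist (p i) (p j) ≤ C * r := by
  obtain ⟨C, hC, hlip, hlight⟩ := hf
  have hext (x : X) : Function.extend Subtype.val f 0 (x : Z) = f x :=
    Subtype.val_injective.extend_apply f 0 x
  have hon : LipschitzOnWith C.toNNReal (Function.extend Subtype.val f 0) X := by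
    refine LipschitzOnWith.of_dist_le_mul fun x hx y hy => ?_
    rw [hext ⟨x, hx⟩, hext ⟨y, hy⟩, Real.coe_toNNReal C hC.le]
    exact hlip ⟨x, hx⟩ ⟨y, hy⟩
  obtain ⟨h, hh, heq⟩ := hon.extend_finite_dimension
  have hval (x : X) : h x = f x := (heq x.2).symm.trans (hext x)
  refine ⟨h, _, C, NNReal.coe_nonneg _, hC, hh.dist_le_mul, fun r hr k p hpX hosc hstep => ?_⟩
  let q : ℕ → X := fun i => ⟨p (min i k), hpX _ (min_le_right _ _)⟩
  have hq : ∀ i ≤ k, (q i : Z) = p i := fun i hi => by simp [q, hi]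
  have key := hlight r hr {w | ∃ i ≤ k, h (p i) = w}
    (by rintro _ ⟨i, hi, rfl⟩ _ ⟨j, hj, rfl⟩; exact hosc i hi j hj) k q
    (fun i hi => ⟨i, hi, by rw [← hval, hq i hi]⟩)
    (fun i hi => by rw [Subtype.dist_eq, hq i hi.le, hq (i + 1) hi]; exact hstep i hi)
  intro i hi j hj
  simpa only [Subtype.dist_eq, hq i hi, hq j hj] using key i hi j hj

/-- If paths with steps at most `r` inside `X` have diameter at most `D`, then a path that reaches
`Y` meets it within distance `D + r` of its starting point. -/
theorem exists_mem_dist_le_of_path {Z : Type*} [MetricSpace Z] {X Y : Set Z}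
    (hXY : X ∪ Y = Set.univ) {D r : ℝ} (hD : 0 ≤ D) (hr : 0 ≤ r) {d : ℕ} {p : ℕ → Z}
    (hX : ∀ e ≤ d, (∀ i ≤ e, p i ∈ X) → dist (p 0) (p e) ≤ D)
    (hstep : ∀ i < d, dist (p i) (p (i + 1)) ≤ r) (hd : p d ∈ Y) :
    ∃ j ≤ d, p j ∈ Y ∧ dist (p 0) (p j) ≤ D + r := by
  classical
  have hex : ∃ j, p j ∈ Y := ⟨d, hd⟩
  have hle : Nat.find hex ≤ d := Nat.find_min' hex hd
  refine ⟨Nat.find hex, hle, Nat.find_spec hex, ?_⟩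
  rcases hj : Nat.find hex with _ | e
  · rw [dist_self]; positivity
  · have hmem : ∀ i ≤ e, p i ∈ X := fun i hi =>
      (hXY.symm ▸ Set.mem_univ (p i) : p i ∈ X ∪ Y).resolve_right
        (Nat.find_min hex (by omega))
    exact (dist_triangle _ (p e) _).trans
      (add_le_add (hX e (by omega) hmem) (hstep e (by omega)))

/-- The concatenation of two Euclidean vectors. -/
noncomputable def euclideanAppend {m n : ℕ} (x : EuclideanSpace ℝ (Fin m))
    (y : EuclideanSpace ℝ (Fin n)) : EuclideanSpace ℝ (Fin (m + n)) :=
  WithLp.toLp 2 (Fin.append x y)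

theorem dist_euclideanAppend {m n : ℕ} (x x' : EuclideanSpace ℝ (Fin m))
    (y y' : EuclideanSpace ℝ (Fin n)) :
    dist (euclideanAppend x y) (euclideanAppend x' y') = √(dist x x' ^ 2 + dist y y' ^ 2) := by
  rw [EuclideanSpace.dist_eq, EuclideanSpace.dist_eq x, EuclideanSpace.dist_eq y,
    Real.sq_sqrt (by positivity), Real.sq_sqrt (by positivity), Fin.sum_univ_add]
  simp [euclideanAppend]

/-- If `Z = X ∪ Y` and both `X` and `Y` (with the induced metric) admit Lipschitz light
maps into `ℝ^m` and `ℝ^n` respectively, then `Z` admits a Lipschitz light map into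
`ℝ^(m+n)`; in particular `dim_L Z ≤ dim_L X + dim_L Y`. -/
theorem stmt1 {Z : Type*} [MetricSpace Z] (m n : ℕ) (X Y : Set Z)
    (hXY : X ∪ Y = Set.univ)
    (f : X → EuclideanSpace ℝ (Fin m)) (g : Y → EuclideanSpace ℝ (Fin n))
    (hf : LipschitzLight f) (hg : LipschitzLight g) :
    ∃ F : Z → EuclideanSpace ℝ (Fin (m + n)), LipschitzLight F := by
  obtain ⟨a, K, A, hK, hA, ha, hAX⟩ := hf.exists_extension
  obtain ⟨b, L, B, hL, hB, hb, hBY⟩ := hg.exists_extension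
  have hleft (z z' : Z) :
      dist (a z) (a z') ≤ dist (euclideanAppend (a z) (b z)) (euclideanAppend (a z') (b z')) := by
    rw [dist_euclideanAppend]
    exact Real.le_sqrt_of_sq_le (le_add_of_nonneg_right (sq_nonneg _))
  have hright (z z' : Z) :
      dist (b z) (b z') ≤ dist (euclideanAppend (a z) (b z)) (euclideanAppend (a z') (b z')) := by
    rw [dist_euclideanAppend]
    exact Real.le_sqrt_of_sq_le (le_add_of_nonneg_left (sq_nonneg _))
  refine ⟨fun z => euclideanAppend (a z) (b z), K + L + (A + B * (2 * A + 3) + 2 * (A + 1)),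
    by positivity, fun z z' => ?_, fun r hr W hW k p hpW hstep => ?_⟩
  · have hsum : dist (euclideanAppend (a z) (b z)) (euclideanAppend (a z') (b z')) ≤
        dist (a z) (a z') + dist (b z) (b z') := by
      rw [dist_euclideanAppend]
      refine Real.sqrt_le_iff.2 ⟨by positivity, ?_⟩
      nlinarith [mul_nonneg (dist_nonneg (x := a z) (y := a z'))
        (dist_nonneg (x := b z) (y := b z'))]
    have hrest : 0 ≤ (A + B * (2 * A + 3) + 2 * (A + 1)) * dist z z' := by positivity
    linarith [ha z z', hb z z']
  have hosc_a : ∀ i ≤ k, ∀ j ≤ k, dist (a (p i)) (a (p j)) ≤ r := fun i hi j hj =>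
    (hleft _ _).trans (hW _ (hpW i hi) _ (hpW j hj))
  have hosc_b : ∀ i ≤ k, ∀ j ≤ k, dist (b (p i)) (b (p j)) ≤ r := fun i hi j hj =>
    (hright _ _).trans (hW _ (hpW i hi) _ (hpW j hj))
  have hKLr : 0 ≤ (K + L) * r := by positivity
  have hAr : 0 ≤ A * r := by positivity
  have hBr : 0 ≤ B * ((2 * A + 3) * r) := by positivity
  by_cases hY : ∃ l ≤ k, p l ∈ Y
  · obtain ⟨l, hl, hlY⟩ := hY
    have hnear : ∀ i, ∃ j, i ≤ k → j ≤ k ∧ p j ∈ Y ∧ dist (p i) (p j) ≤ A * r + r := by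
      intro i
      by_cases hi : i ≤ k
      swap
      · exact ⟨0, fun h => absurd h hi⟩
      rcases le_total i l with hil | hli
      · obtain ⟨j, hj, hjY, hdist⟩ := exists_mem_dist_le_of_path hXY hAr hr.le
          (d := l - i) (p := fun t => p (i + t))
          (fun e he hmem => hAX r hr e _ hmem
            (fun s hs t ht => hosc_a _ (by omega) _ (by omega))
            (fun s hs => hstep _ (by omega)) 0 (Nat.zero_le _) e le_rfl)
          (fun s hs => hstep _ (by omega)) (by simpa [Nat.add_sub_cancel' hil] using hlY)
        exact ⟨i + j, fun _ => ⟨by omega, hjY, hdist⟩⟩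
      · have hback : ∀ s < i - l, dist (p (i - s)) (p (i - (s + 1))) ≤ r := fun s hs => by
          rw [dist_comm, show i - s = i - (s + 1) + 1 by omega]
          exact hstep _ (by omega)
        obtain ⟨j, hj, hjY, hdist⟩ := exists_mem_dist_le_of_path hXY hAr hr.le
          (d := i - l) (p := fun t => p (i - t))
          (fun e he hmem => hAX r hr e _ hmem
            (fun s hs t ht => hosc_a _ (by omega) _ (by omega))
            (fun s hs => hback s (by omega)) 0 (Nat.zero_le _) e le_rfl)
          hback (by simpa [Nat.sub_sub_self hli] using hlY)
        exact ⟨i - j, fun _ => ⟨by omega, hjY, hdist⟩⟩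
    choose q hq using hnear
    have hq_path : ∀ i < k, dist (p (q i)) (p (q (i + 1))) ≤ (2 * A + 3) * r := fun i hi => by
      have h₁ := (hq i hi.le).2.2
      have h₂ := (hq (i + 1) hi).2.2
      have h₃ := dist_triangle4 (p (q i)) (p i) (p (i + 1)) (p (q (i + 1)))
      rw [dist_comm (p (q i)) (p i)] at h₃
      linarith [hstep i hi]
    intro i hi j hj
    have h₁ := (hq i hi).2.2
    have h₂ := (hq j hj).2.2
    have h₃ := hBY ((2 * A + 3) * r) (by positivity) k (p ∘ q) (fun i hi => (hq i hi).2.1)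
      (fun s hs t ht => (hosc_b _ (hq s hs).1 _ (hq t ht).1).trans (by linarith))
      hq_path i hi j hj
    have h₄ := dist_triangle4 (p i) (p (q i)) (p (q j)) (p j)
    rw [dist_comm (p (q j)) (p j)] at h₄
    simp only [Function.comp_apply] at h₃
    linarith
  · push Not at hY
    intro i hi j hj
    have h := hAX r hr k p
      (fun i hi => (hXY.symm ▸ Set.mem_univ (p i) : p i ∈ X ∪ Y).resolve_right (hY i hi))
      hosc_a hstep i hi j hj
    linarith
end

section
/- Let X and Y be metric spaces, let f : X → Y be 1-Lipschitz, let h : X × [0,∞) → X be a map, and let λ, μ > 0 be constants such that: (i) for every non-empty bounded subset C ⊆ Y there exists y ∈ Y such that f⁻¹(C) is contained in the closed λ·diam(C)-neighborhood of f⁻¹(y); (ii) d(h(x,t), x) ≤ t for all x ∈ X and t ≥ 0; (iii) whenever f(x) = f(x') and t ≥ μ·d(x,x'), one has h(x,t) = h(x',t). Then f is Lipschitz light. -/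
open Metric Set

/-- The Lang–Schlichenmaier criterion: a `1`-Lipschitz map `f` admitting a "folding"
map `h` as below is Lipschitz light. -/
theorem stmt2 {X Y : Type*} [MetricSpace X] [MetricSpace Y]
    (f : X → Y) (h : X → ℝ → X) (lam mu : ℝ) (hlam : 0 < lam) (hmu : 0 < mu)
    (hf : ∀ x x', dist (f x) (f x') ≤ dist x x')
    (h1 : ∀ C : Set Y, C.Nonempty → Bornology.IsBounded C →
      ∃ y : Y, f ⁻¹' C ⊆ Metric.cthickening (lam * Metric.diam C) (f ⁻¹' {y}))
    (h2 : ∀ (x : X), ∀ t : ℝ, 0 ≤ t → dist (h x t) x ≤ t)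
    (h3 : ∀ (x x' : X), ∀ t : ℝ, f x = f x' → mu * dist x x' ≤ t → h x t = h x' t) :
    LipschitzLight f := by
  refine ⟨2 * (mu * (2 * lam + 3)) + 2 * (lam + 1), by positivity, ?_, ?_⟩
  · intro x x'
    refine (hf x x').trans (le_mul_of_one_le_left dist_nonneg ?_)
    have : 0 < mu * (2 * lam + 3) := by positivity
    linarith
  intro r hr W hW k p hp hstep
  have hne : W.Nonempty := ⟨f (p 0), hp 0 (Nat.zero_le k)⟩
  obtain ⟨y, hy⟩ := h1 W hne (Metric.isBounded_iff.2 ⟨r, fun _ hw _ hw' => hW _ hw _ hw'⟩)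
  have hdiam : Metric.diam W ≤ r := Metric.diam_le_of_forall_dist_le hr.le hW
  have hnear : ∀ i, ∃ q, i ≤ k → f q = y ∧ dist (p i) q ≤ (lam + 1) * r := by
    intro i
    by_cases hi : i ≤ k
    · have hlt : lam * Metric.diam W < (lam + 1) * r := by
        nlinarith [mul_le_mul_of_nonneg_left hdiam hlam.le]
      obtain ⟨q, hq, hpq⟩ := Metric.mem_thickening_iff.1
        (Metric.cthickening_subset_thickening' (by positivity) hlt _ (hy (hp i hi)))
      exact ⟨q, fun _ => ⟨hq, hpq.le⟩⟩
    · exact ⟨p i, fun hi' => absurd hi' hi⟩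
  choose q hq using hnear
  set t := mu * ((2 * lam + 3) * r) with ht
  have hconst : ∀ i ≤ k, h (q i) t = h (q 0) t := by
    intro i
    induction i with
    | zero => exact fun _ => rfl
    | succ i ih =>
      intro hi
      obtain ⟨hqi, hpqi⟩ := hq i (by omega)
      obtain ⟨hqi', hpqi'⟩ := hq (i + 1) hi
      rw [← ih (by omega)]
      refine h3 _ _ _ (hqi'.trans hqi.symm) (mul_le_mul_of_nonneg_left ?_ hmu.le)
      have htri := dist_triangle4 (q i) (p i) (p (i + 1)) (q (i + 1))
      rw [dist_comm (q i) (p i), dist_comm (q i) (q (i + 1))] at htri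
      linarith [hstep i (by omega)]
  intro i hi j hj
  have ht0 : 0 ≤ t := by positivity
  have hqij : dist (q i) (q j) ≤ t + t := by
    have hi' := h2 (q i) t ht0
    have hj' := h2 (q j) t ht0
    rw [hconst i hi] at hi'
    rw [hconst j hj] at hj'
    exact (dist_triangle_left _ _ _).trans (add_le_add hi' hj')
  have htri := dist_triangle4 (p i) (q i) (q j) (p j)
  rw [dist_comm (q j) (p j)] at htri
  linarith [(hq i hi).2, (hq j hj).2]
end

section
/- For every ε ∈ (0,1], the ε-snowflake of the real line, i.e. the metric space X_ε = (ℝ, d_ε) with d_ε(x,y) = |x − y|^ε, has Lipschitz dimension 1: there exists a Lipschitz light map f : X_ε → ℝ, and there is no constant C > 0 such that for every r > 0 every r-path in X_ε has diameter at most C·r (so the Lipschitz dimension is not 0). -/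
open Metric Set

/-- Lipschitz lightness with respect to explicitly given distance functions `dX`, `dY`. -/
def LipschitzLightWithD {X Y : Type*} (dX : X → X → ℝ) (dY : Y → Y → ℝ)
    (C : ℝ) (f : X → Y) : Prop :=
  (∀ x x', dY (f x) (f x') ≤ C * dX x x') ∧
  ∀ r > 0, ∀ W : Set Y, (∀ w ∈ W, ∀ w' ∈ W, dY w w' ≤ r) →
    ∀ (k : ℕ) (p : ℕ → X), (∀ i ≤ k, f (p i) ∈ W) →
      (∀ i < k, dX (p i) (p (i + 1)) ≤ r) →
      ∀ i ≤ k, ∀ j ≤ k, dX (p i) (p j) ≤ C * r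


/-- The two-sided Weierstrass series `∑ b⁻ⁿ (cos (aⁿ x) - 1)`, summed over all integers `n`. -/
noncomputable def weierstrassSeries (a b x : ℝ) : ℝ :=
  ∑' n : ℤ, (b ^ n)⁻¹ * (Real.cos (a ^ n * x) - 1)

lemma abs_cos_sub_cos_le (x y : ℝ) : |Real.cos x - Real.cos y| ≤ min |x - y| 2 := by
  refine le_min ?_ ?_
  · rw [Real.cos_sub_cos, abs_mul, abs_mul, abs_neg, abs_two]
    have h1 := Real.abs_sin_le_one ((x + y) / 2)
    have h2 : |Real.sin ((x - y) / 2)| ≤ |(x - y) / 2| := Real.abs_sin_le_abs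
    rw [abs_div, abs_two] at h2
    nlinarith [abs_nonneg (Real.sin ((x - y) / 2))]
  · rw [abs_le]
    constructor <;> linarith [Real.cos_le_one x, Real.cos_le_one y, Real.neg_one_le_cos x,
      Real.neg_one_le_cos y]

lemma abs_weierstrass_term_sub_le {a b : ℝ} (ha : 0 < a) (hb : 0 < b) (n : ℤ) {x y D : ℝ}
    (h : |x - y| ≤ D) :
    |(b ^ n)⁻¹ * (Real.cos (a ^ n * x) - 1) - (b ^ n)⁻¹ * (Real.cos (a ^ n * y) - 1)| ≤
      (b ^ n)⁻¹ * min (a ^ n * D) 2 := by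
  have h1 : (b ^ n)⁻¹ * (Real.cos (a ^ n * x) - 1) - (b ^ n)⁻¹ * (Real.cos (a ^ n * y) - 1) =
    (b ^ n)⁻¹ * (Real.cos (a ^ n * x) - Real.cos (a ^ n * y)) := by ring
  have hbn : 0 < (b ^ n)⁻¹ := by positivity
  have han : 0 < a ^ n := by positivity
  rw [h1, abs_mul, abs_of_pos hbn]
  refine mul_le_mul_of_nonneg_left ((abs_cos_sub_cos_le _ _).trans ?_) hbn.le
  rw [← mul_sub, abs_mul, abs_of_pos han]
  exact min_le_min_right _ (mul_le_mul_of_nonneg_left h han.le)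

lemma summable_weierstrass_bound {a b : ℝ} (hb : 1 < b) (hab : b < a) {D : ℝ} (hD : 0 ≤ D) :
    Summable fun n : ℤ => (b ^ n)⁻¹ * min (a ^ n * D) 2 := by
  have hb0 : 0 < b := by linarith
  have ha0 : 0 < a := by linarith
  refine Summable.of_nat_of_neg ?_ ?_
  · refine Summable.of_nonneg_of_le (fun n => by positivity) (fun n => ?_)
      ((summable_geometric_of_lt_one (r := b⁻¹) (by positivity)
        (inv_lt_one_of_one_lt₀ hb)).mul_right 2)
    rw [zpow_natCast, inv_pow]
    exact mul_le_mul_of_nonneg_left (min_le_right _ _) (by positivity)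
  · refine Summable.of_nonneg_of_le (fun n => by positivity) (fun n => ?_)
      ((summable_geometric_of_lt_one (r := b / a) (by positivity)
        ((div_lt_one ha0).2 hab)).mul_right D)
    rw [zpow_neg, zpow_neg, zpow_natCast, zpow_natCast, inv_inv, div_pow, div_eq_mul_inv,
      mul_assoc]
    exact mul_le_mul_of_nonneg_left (min_le_left _ _) (by positivity)

lemma summable_weierstrass_term {a b : ℝ} (hb : 1 < b) (hab : b < a) (x : ℝ) :
    Summable fun n : ℤ => (b ^ n)⁻¹ * (Real.cos (a ^ n * x) - 1) := by
  refine Summable.of_norm_bounded (summable_weierstrass_bound hb hab (abs_nonneg x)) fun n => ?_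
  have := abs_weierstrass_term_sub_le (a := a) (b := b) (by linarith) (by linarith) n
    (x := x) (y := 0) (D := |x|) (by simp)
  simpa using this

lemma weierstrassSeries_zpow_mul {a b : ℝ} (ha : a ≠ 0) (hb : b ≠ 0) (N : ℤ) (x : ℝ) :
    weierstrassSeries a b (a ^ N * x) = b ^ N * weierstrassSeries a b x := by
  unfold weierstrassSeries
  rw [← tsum_mul_left, ← (Equiv.addRight N).tsum_eq
    (fun n : ℤ => b ^ N * ((b ^ n)⁻¹ * (Real.cos (a ^ n * x) - 1)))]
  refine tsum_congr fun n => ?_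
  have : b ^ N ≠ 0 := zpow_ne_zero _ hb
  have : b ^ n ≠ 0 := zpow_ne_zero _ hb
  simp only [Equiv.coe_addRight, zpow_add₀ ha, zpow_add₀ hb]
  field_simp

lemma abs_weierstrassSeries_sub_le {a b : ℝ} (hb : 1 < b) (hab : b < a) {x y D : ℝ}
    (h : |x - y| ≤ D) :
    |weierstrassSeries a b x - weierstrassSeries a b y| ≤
      ∑' n : ℤ, (b ^ n)⁻¹ * min (a ^ n * D) 2 := by
  unfold weierstrassSeries
  rw [← (summable_weierstrass_term hb hab x).tsum_sub (summable_weierstrass_term hb hab y)]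
  refine tsum_of_norm_bounded
    (f := fun n : ℤ => (b ^ n)⁻¹ * (Real.cos (a ^ n * x) - 1) -
      (b ^ n)⁻¹ * (Real.cos (a ^ n * y) - 1))
    (summable_weierstrass_bound hb hab ((abs_nonneg _).trans h)).hasSum fun n => ?_
  exact abs_weierstrass_term_sub_le (by linarith) (by linarith) n h

/-- When the base is an even integer, the terms of positive index agree at `2πj` and `2πj + π`. -/
lemma one_le_weierstrassSeries_sub {m : ℕ} {b : ℝ} (hb : 1 < b) (hab : 5 * b ≤ (2 * m : ℕ))
    (j : ℤ) :
    1 ≤ weierstrassSeries (2 * m : ℕ) b (2 * Real.pi * j) -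
      weierstrassSeries (2 * m : ℕ) b (2 * Real.pi * j + Real.pi) := by
  set a : ℝ := ((2 * m : ℕ) : ℝ) with ha
  have hba : b < a := by linarith
  have ha0 : 0 < a := by linarith
  have hb0 : 0 < b := by linarith
  set F : ℤ → ℝ := fun n => (b ^ n)⁻¹ * (Real.cos (a ^ n * (2 * Real.pi * j)) - 1) -
    (b ^ n)⁻¹ * (Real.cos (a ^ n * (2 * Real.pi * j + Real.pi)) - 1) with hF
  have hs : Summable F :=
    (summable_weierstrass_term hb hba _).sub (summable_weierstrass_term hb hba _)
  have hfs : weierstrassSeries a b (2 * Real.pi * j) -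
      weierstrassSeries a b (2 * Real.pi * j + Real.pi) = ∑' n, F n :=
    ((summable_weierstrass_term hb hba _).tsum_sub (summable_weierstrass_term hb hba _)).symm
  have hpos : ∀ n : ℕ, F ((n : ℤ) + 1) = 0 := by
    intro n
    have hcast : a ^ ((n : ℤ) + 1) = ((2 * m : ℕ) : ℝ) ^ (n + 1) := by
      rw [ha]; exact_mod_cast rfl
    have h1 : Real.cos (a ^ ((n : ℤ) + 1) * (2 * Real.pi * j)) = 1 := by
      rw [hcast, Real.cos_eq_one_iff]
      refine ⟨(2 * m : ℕ) ^ (n + 1) * j, ?_⟩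
      push_cast; ring
    have h2 : Real.cos (a ^ ((n : ℤ) + 1) * (2 * Real.pi * j + Real.pi)) = 1 := by
      rw [hcast, Real.cos_eq_one_iff]
      refine ⟨(2 * m : ℕ) ^ (n + 1) * j + m * (2 * m : ℕ) ^ n, ?_⟩
      push_cast; ring
    simp only [hF, h1, h2]; ring
  have hzero : F 0 = 2 := by
    have h1 : Real.cos (2 * Real.pi * j) = 1 := by
      rw [Real.cos_eq_one_iff]; exact ⟨j, by ring⟩
    simp only [hF, zpow_zero, one_mul, Real.cos_add_pi, h1]; norm_num
  have hρ : b / a ≤ 1 / 5 := by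
    rw [div_le_div_iff₀ ha0 (by norm_num)]; linarith
  have hρ0 : 0 < b / a := by positivity
  have hgeo : HasSum (fun n : ℕ => Real.pi * (b / a) * (b / a) ^ n)
      (Real.pi * (b / a) * (1 - b / a)⁻¹) :=
    (hasSum_geometric_of_lt_one hρ0.le (by linarith)).mul_left _
  have hneg : |∑' n : ℕ, F (-((n : ℤ) + 1))| ≤ Real.pi * (b / a) * (1 - b / a)⁻¹ := by
    refine tsum_of_norm_bounded (f := fun n : ℕ => F (-((n : ℤ) + 1))) hgeo fun n => ?_
    have := abs_weierstrass_term_sub_le ha0 hb0 (-((n : ℤ) + 1)) (x := 2 * Real.pi * j)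
      (y := 2 * Real.pi * j + Real.pi) (D := Real.pi)
      (by simp [abs_of_pos Real.pi_pos])
    refine (this.trans (mul_le_mul_of_nonneg_left (min_le_left _ _) (by positivity))).trans_eq ?_
    have hz : ∀ x : ℝ, x ^ (-((n : ℤ) + 1)) = (x ^ (n + 1))⁻¹ := fun x => by
      rw [zpow_neg]; exact_mod_cast rfl
    rw [hz, hz, inv_inv, mul_assoc Real.pi, ← pow_succ', div_pow]
    ring
  have hsum : ∑' n, F n = ∑' n : ℕ, F n + ∑' n : ℕ, F (-((n : ℤ) + 1)) :=
    tsum_of_nat_of_neg_add_one (hs.comp_injective Nat.cast_injective)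
      (hs.comp_injective (i := fun n : ℕ => -((n : ℤ) + 1)) fun x y h => by
        simp only at h; omega)
  have hnonneg : ∑' n : ℕ, F n = 2 := by
    rw [tsum_eq_single 0, Nat.cast_zero, hzero]
    intro n hn
    obtain ⟨k, rfl⟩ := Nat.exists_eq_succ_of_ne_zero hn
    exact_mod_cast hpos k
  have hle : Real.pi * (b / a) * (1 - b / a)⁻¹ ≤ 1 := by
    rw [← div_eq_mul_inv, div_le_one (by linarith)]
    nlinarith [Real.pi_lt_four]
  rw [hfs, hsum, hnonneg]
  linarith [neg_abs_le (∑' n : ℕ, F (-((n : ℤ) + 1)))]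

lemma exists_even_base {ε : ℝ} (hε0 : 0 < ε) (hε1 : ε < 1) :
    ∃ m : ℕ, 1 < ((2 * m : ℕ) : ℝ) ^ ε ∧ 5 * ((2 * m : ℕ) : ℝ) ^ ε ≤ (2 * m : ℕ) := by
  have h := ((tendsto_rpow_atTop (show 0 < 1 - ε by linarith)).comp
    tendsto_natCast_atTop_atTop).eventually_ge_atTop 5
  obtain ⟨K, hK⟩ := Filter.eventually_atTop.1 h
  refine ⟨K + 1, Real.one_lt_rpow (by push_cast; linarith [K.cast_nonneg (α := ℝ)]) hε0, ?_⟩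
  have h5 := hK (2 * (K + 1)) (by omega)
  simp only [Function.comp_apply] at h5
  have hpos : (0 : ℝ) < (2 * (K + 1) : ℕ) := by positivity
  calc 5 * ((2 * (K + 1) : ℕ) : ℝ) ^ ε
      ≤ ((2 * (K + 1) : ℕ) : ℝ) ^ (1 - ε) * ((2 * (K + 1) : ℕ) : ℝ) ^ ε := by gcongr
    _ = (2 * (K + 1) : ℕ) := by rw [← Real.rpow_add hpos]; simp

/-- For every `ε ∈ (0, 1]` there is an `ε`-Hölder function on the line whose oscillation on every
interval is comparable to the `ε`-th power of its length. -/
lemma exists_holder_oscillation {ε : ℝ} (hε0 : 0 < ε) (hε1 : ε ≤ 1) :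
    ∃ f : ℝ → ℝ, ∃ L > 0, ∃ c > 0, (∀ x y, |f x - f y| ≤ L * |x - y| ^ ε) ∧
      ∀ x y, x < y → ∃ u ∈ Icc x y, ∃ v ∈ Icc x y, c * (y - x) ^ ε ≤ |f u - f v| := by
  rcases hε1.eq_or_lt with rfl | hε1
  · refine ⟨id, 1, one_pos, 1, one_pos, by simp, fun x y h => ?_⟩
    exact ⟨y, ⟨h.le, le_rfl⟩, x, ⟨le_rfl, h.le⟩, by simp [abs_of_pos (sub_pos.2 h)]⟩
  obtain ⟨m, hb, hab⟩ := exists_even_base hε0 hε1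
  set a : ℝ := ((2 * m : ℕ) : ℝ) with ha
  set b : ℝ := a ^ ε with hbdef
  have hba : b < a := by linarith
  have ha1 : 1 < a := by linarith
  have ha0 : 0 < a := by linarith
  have hb0 : 0 < b := by linarith
  have hbz : ∀ N : ℤ, (a ^ N) ^ ε = b ^ N := fun N => by
    rw [hbdef, ← Real.rpow_intCast, ← Real.rpow_intCast, ← Real.rpow_mul ha0.le,
      ← Real.rpow_mul ha0.le, mul_comm]
  have hresc : ∀ (N : ℤ) (x y : ℝ),
      |weierstrassSeries a b (a ^ N * x) - weierstrassSeries a b (a ^ N * y)| =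
        b ^ N * |weierstrassSeries a b x - weierstrassSeries a b y| := fun N x y => by
    rw [weierstrassSeries_zpow_mul ha0.ne' hb0.ne', weierstrassSeries_zpow_mul ha0.ne' hb0.ne',
      ← mul_sub, abs_mul, abs_of_pos (zpow_pos hb0 N)]
  have hS : 0 ≤ ∑' n : ℤ, (b ^ n)⁻¹ * min (a ^ n * a) 2 := tsum_nonneg fun n => by positivity
  refine ⟨weierstrassSeries a b, (∑' n : ℤ, (b ^ n)⁻¹ * min (a ^ n * a) 2) + 1, by positivity,
    ((4 * Real.pi * a) ^ ε)⁻¹, by positivity, fun x y => ?_, fun x y hxy => ?_⟩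
  · rcases eq_or_ne x y with rfl | hne
    · simp [Real.zero_rpow hε0.ne']
    have hd : 0 < |x - y| := abs_pos.2 (sub_ne_zero.2 hne)
    obtain ⟨N, hN1, hN2⟩ := exists_mem_Ico_zpow hd ha1
    have h1 : |a ^ (-N) * x - a ^ (-N) * y| ≤ a := by
      rw [← mul_sub, abs_mul, abs_of_pos (zpow_pos ha0 _), zpow_neg,
        inv_mul_le_iff₀ (zpow_pos ha0 _), ← zpow_add_one₀ ha0.ne']
      exact hN2.le
    have h2 := abs_weierstrassSeries_sub_le hb hba h1
    rw [hresc, zpow_neg, inv_mul_le_iff₀ (zpow_pos hb0 _), mul_comm] at h2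
    refine h2.trans (mul_le_mul (by linarith) ?_ (by positivity) (by positivity))
    rw [← hbz]
    exact Real.rpow_le_rpow (zpow_pos ha0 _).le hN1 hε0.le
  · have hd : 0 < y - x := sub_pos.2 hxy
    obtain ⟨N, hN1, hN2⟩ := exists_mem_Ico_zpow (div_pos hd (mul_pos four_pos Real.pi_pos)) ha1
    rw [le_div_iff₀ (by positivity)] at hN1
    rw [div_lt_iff₀ (by positivity), zpow_add_one₀ ha0.ne'] at hN2
    have haN : 0 < a ^ N := zpow_pos ha0 N
    have hbN : 0 < b ^ N := zpow_pos hb0 N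
    set j : ℤ := ⌈x / (a ^ N * (2 * Real.pi))⌉ with hj
    have hj1 : x ≤ j * (a ^ N * (2 * Real.pi)) :=
      (div_le_iff₀ (by positivity)).1 (Int.le_ceil _)
    have hj2 : j * (a ^ N * (2 * Real.pi)) < x + a ^ N * (2 * Real.pi) := by
      have := Int.ceil_lt_add_one (x / (a ^ N * (2 * Real.pi)))
      rw [← hj, div_add_one (by positivity), lt_div_iff₀ (by positivity)] at this
      exact this
    have hpN : 0 < a ^ N * Real.pi := by positivity
    refine ⟨a ^ N * (2 * Real.pi * j), ⟨by linarith, by linarith⟩,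
      a ^ N * (2 * Real.pi * j + Real.pi), ⟨by linarith, by linarith⟩, ?_⟩
    rw [hresc]
    have h1 := (one_le_weierstrassSeries_sub hb hab j).trans (le_abs_self _)
    refine le_trans ?_ (le_mul_of_one_le_right hbN.le h1)
    rw [inv_mul_le_iff₀ (by positivity), ← hbz, ← Real.mul_rpow (by positivity) haN.le]
    exact Real.rpow_le_rpow hd.le (by linarith) hε0.le

/-- Discrete intermediate value theorem for `δ`-paths in the line. -/
lemma exists_path_point_near {δ : ℝ} (hδ : 0 ≤ δ) {k : ℕ} {p : ℕ → ℝ}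
    (hp : ∀ i < k, |p i - p (i + 1)| ≤ δ) {i j : ℕ} (hi : i ≤ k) (hj : j ≤ k) {z : ℝ}
    (hz : z ∈ Icc (p i) (p j)) : ∃ m ≤ k, |z - p m| ≤ δ := by
  by_contra! h
  have hside : ∀ m ≤ k, (p m < z ↔ p 0 < z) := by
    intro m
    induction m with
    | zero => simp
    | succ m ih =>
      intro hm
      rw [← ih (by omega)]
      have h1 := h m (by omega)
      have h2 := h (m + 1) hm
      have h3 := abs_le.1 (hp m (by omega))
      constructor <;> intro h4 <;> by_contra! h5
      · rw [abs_of_nonpos (by linarith)] at h1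
        rw [abs_of_pos (by linarith)] at h2
        linarith
      · rw [abs_of_pos (by linarith)] at h1
        rw [abs_of_nonpos (by linarith)] at h2
        linarith
  have hi' : p i < z := by
    refine hz.1.lt_of_ne fun he => ?_
    have := h i hi
    rw [he, sub_self, abs_zero] at this
    linarith
  exact hz.2.not_gt ((hside j hj).2 ((hside i hi).1 hi'))

lemma rpow_path_diam_le {ε : ℝ} (hε0 : 0 < ε) {f : ℝ → ℝ} {L c : ℝ} (hL : 0 < L) (hc : 0 < c)
    (hf : ∀ x y, |f x - f y| ≤ L * |x - y| ^ ε)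
    (hosc : ∀ x y, x < y → ∃ u ∈ Icc x y, ∃ v ∈ Icc x y, c * (y - x) ^ ε ≤ |f u - f v|)
    {r : ℝ} (hr : 0 < r) {W : Set ℝ} (hW : ∀ w ∈ W, ∀ w' ∈ W, dist w w' ≤ r) {k : ℕ} {p : ℕ → ℝ}
    (hpW : ∀ i ≤ k, f (p i) ∈ W) (hp : ∀ i < k, |p i - p (i + 1)| ^ ε ≤ r)
    {i j : ℕ} (hi : i ≤ k) (hj : j ≤ k) (hij : p i < p j) :
    |p i - p j| ^ ε ≤ (2 * L + 1) / c * r := by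
  have hp' : ∀ i < k, |p i - p (i + 1)| ≤ r ^ ε⁻¹ := fun i hi =>
    (Real.le_rpow_inv_iff_of_pos (abs_nonneg _) hr.le hε0).2 (hp i hi)
  have hnear : ∀ z ∈ Icc (p i) (p j), ∃ m ≤ k, |f z - f (p m)| ≤ L * r := by
    intro z hz
    obtain ⟨m, hm, hzm⟩ := exists_path_point_near (by positivity) hp' hi hj hz
    refine ⟨m, hm, (hf _ _).trans (mul_le_mul_of_nonneg_left ?_ hL.le)⟩
    exact (Real.le_rpow_inv_iff_of_pos (abs_nonneg _) hr.le hε0).1 hzm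
  obtain ⟨u, hu, v, hv, huv⟩ := hosc _ _ hij
  obtain ⟨s, hs, hus⟩ := hnear u hu
  obtain ⟨t, ht, hvt⟩ := hnear v hv
  have hst := hW _ (hpW s hs) _ (hpW t ht)
  rw [Real.dist_eq] at hst
  have h1 := abs_sub_le (f u) (f (p s)) (f v)
  have h2 := abs_sub_le (f (p s)) (f (p t)) (f v)
  rw [abs_sub_comm (f (p t))] at h2
  rw [abs_sub_comm, abs_of_pos (sub_pos.2 hij), div_mul_eq_mul_div, le_div_iff₀ hc]
  linarith

/-- The `ε`-snowflake `(ℝ, |x - y|^ε)` has Lipschitz dimension `1`: it admits a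
Lipschitz light map to `ℝ`, but its Lipschitz dimension is not `0`. -/
theorem stmt3 (ε : ℝ) (hε0 : 0 < ε) (hε1 : ε ≤ 1) :
    (∃ C > 0, ∃ f : ℝ → ℝ,
        LipschitzLightWithD (fun x y => |x - y| ^ ε) dist C f) ∧
    ¬ ∃ C > 0, ∀ r > 0, ∀ (k : ℕ) (p : ℕ → ℝ),
        (∀ i < k, |p i - p (i + 1)| ^ ε ≤ r) →
        ∀ i ≤ k, ∀ j ≤ k, |p i - p j| ^ ε ≤ C * r := by
  constructor
  · obtain ⟨f, L, hL, c, hc, hf, hosc⟩ := exists_holder_oscillation hε0 hε1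
    refine ⟨max L ((2 * L + 1) / c), lt_max_of_lt_left hL, f, fun x y => ?_, ?_⟩
    · exact (hf x y).trans (mul_le_mul_of_nonneg_right (le_max_left _ _) (by positivity))
    · intro r hr W hW k p hpW hp i hi j hj
      have hC : (2 * L + 1) / c * r ≤ max L ((2 * L + 1) / c) * r :=
        mul_le_mul_of_nonneg_right (le_max_right _ _) hr.le
      refine le_trans ?_ hC
      rcases lt_trichotomy (p i) (p j) with h | h | h
      · exact rpow_path_diam_le hε0 hL hc hf hosc hr hW hpW hp hi hj h
      · simp only [h, sub_self, abs_zero, Real.zero_rpow hε0.ne']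
        positivity
      · beta_reduce
        rw [abs_sub_comm]
        exact rpow_path_diam_le hε0 hL hc hf hosc hr hW hpW hp hj hi h
  · rintro ⟨C, -, h⟩
    obtain ⟨k, hk⟩ := (((tendsto_rpow_atTop hε0).comp
      tendsto_natCast_atTop_atTop).eventually_gt_atTop C).exists
    have := h 1 one_pos k (fun i => (i : ℝ)) (fun i _ => by simp) k le_rfl 0 (Nat.zero_le k)
    simp only [Nat.cast_zero, sub_zero, Nat.abs_cast, mul_one] at this
    exact hk.not_ge this
end

section
/- For every ε ∈ (0,1] and every integer n ≥ 1, the ε-snowflake of ℝ^n, i.e. the metric space (ℝ^n, d_ε) with d_ε(x,y) = ‖x − y‖^ε (Euclidean norm), has Lipschitz dimension exactly n: there exists a Lipschitz light map (ℝ^n, d_ε) → ℝ^n, and (for n ≥ 2) there is no Lipschitz light map (ℝ^n, d_ε) → ℝ^{n−1}. -/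
open Metric Set

/-- The `k`-th vertex of the Kuhn simplex based at `z` whose `i`-th direction is traversed
at step `σ i`. -/
def kuhnVertex {R : Type*} [Add R] [Zero R] [One R] {n : ℕ} (z : Fin n → R)
    (σ : Equiv.Perm (Fin n)) (k : ℕ) : Fin n → R :=
  fun i => z i + if (σ i : ℕ) < k then 1 else 0

lemma kuhnVertex_swap {R : Type*} [Add R] [Zero R] [One R] {m : ℕ} (z : Fin (m + 1) → R)
    (σ : Equiv.Perm (Fin (m + 1))) (i : Fin m) {k : ℕ} (hk : k ≠ i + 1) :
    kuhnVertex z (Equiv.swap i.castSucc i.succ * σ) k = kuhnVertex z σ k := by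
  funext j
  refine congrArg (z j + ·) (if_congr ?_ rfl rfl)
  rw [Equiv.Perm.mul_apply]
  rcases eq_or_ne (σ j) i.castSucc with h | h
  · rw [h, Equiv.swap_apply_left, Fin.val_succ, Fin.val_castSucc]
    omega
  · rcases eq_or_ne (σ j) i.succ with h' | h'
    · rw [h', Equiv.swap_apply_right, Fin.val_succ, Fin.val_castSucc]
      omega
    · rw [Equiv.swap_apply_of_ne_of_ne h h']

lemma sum_kuhnVertex_inner_face {R : Type*} [Add R] [Zero R] [One R] {m : ℕ}
    (z : Fin (m + 1) → R) (g : (Fin (m + 1) → Fin (m + 1) → R) → ℤ) (i : Fin m) :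
    ∑ σ : Equiv.Perm (Fin (m + 1)), (Equiv.Perm.sign σ : ℤ) *
      g (fun j => kuhnVertex z σ (i.castSucc.succ.succAbove j : Fin (m + 2))) = 0 := by
  have h := Equiv.sum_comp (Equiv.mulLeft (Equiv.swap i.castSucc i.succ))
    (fun σ : Equiv.Perm (Fin (m + 1)) => (Equiv.Perm.sign σ : ℤ) *
      g (fun j => kuhnVertex z σ (i.castSucc.succ.succAbove j : Fin (m + 2))))
  have hne : i.castSucc ≠ i.succ := (Fin.castSucc_lt_succ).ne
  have h2 : ∀ σ : Equiv.Perm (Fin (m + 1)),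
      (fun j => kuhnVertex z (Equiv.swap i.castSucc i.succ * σ)
        (i.castSucc.succ.succAbove j : Fin (m + 2))) =
      (fun j => kuhnVertex z σ (i.castSucc.succ.succAbove j : Fin (m + 2))) := by
    intro σ
    funext j
    refine kuhnVertex_swap z σ i ?_
    intro hj
    exact Fin.succAbove_ne i.castSucc.succ j (Fin.ext (by simpa using hj))
  simp only [Equiv.coe_mulLeft, h2, Equiv.Perm.sign_mul, Equiv.Perm.sign_swap hne] at h
  simp only [neg_mul, one_mul, Units.val_neg, Finset.sum_neg_distrib] at h
  linarith

lemma kuhnVertex_rotate {R : Type*} [AddCommGroup R] [One R] {m : ℕ} (z : Fin (m + 1) → R)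
    (σ : Equiv.Perm (Fin (m + 1))) {k : ℕ} (hk : k ≤ m) :
    kuhnVertex (fun i => z i + if σ i = 0 then 1 else 0) ((finRotate (m + 1))⁻¹ * σ) k =
      kuhnVertex z σ (k + 1) := by
  funext j
  obtain ⟨s, hs⟩ : ∃ s, σ j = finRotate (m + 1) s := ⟨(finRotate (m + 1)).symm (σ j), by simp⟩
  have hs' : ((finRotate (m + 1))⁻¹ * σ) j = s := by
    rw [Equiv.Perm.mul_apply, hs, Equiv.Perm.inv_def, Equiv.symm_apply_apply]
  simp only [kuhnVertex, add_assoc, hs', hs]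
  congr 1
  rcases Fin.eq_castSucc_or_eq_last s with ⟨t, rfl⟩ | rfl
  · have : finRotate (m + 1) t.castSucc = t.succ := by
      simp
    simp [this, Fin.succ_ne_zero]
  · have : ¬ m < k := not_lt.mpr hk
    simp [this]

lemma sum_kuhnVertex_outer_face {R : Type*} [AddCommGroup R] [One R] [Fintype R] {m : ℕ}
    (g : (Fin (m + 1) → Fin (m + 1) → R) → ℤ) :
    ∑ z : Fin (m + 1) → R, ∑ σ : Equiv.Perm (Fin (m + 1)), (Equiv.Perm.sign σ : ℤ) *
      g (fun j => kuhnVertex z σ (j + 1)) =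
    (-1) ^ m * ∑ z : Fin (m + 1) → R, ∑ σ : Equiv.Perm (Fin (m + 1)),
      (Equiv.Perm.sign σ : ℤ) * g (fun j => kuhnVertex z σ j) := by
  rw [Finset.sum_comm]
  conv_rhs => rw [Finset.sum_comm,
    ← Equiv.sum_comp (Equiv.mulLeft ((finRotate (m + 1))⁻¹))]
  rw [Finset.mul_sum]
  refine Finset.sum_congr rfl fun σ _ => ?_
  conv_rhs => rw [← Equiv.sum_comp (Equiv.addRight (fun i => if σ i = 0 then (1 : R) else 0))]
  rw [Finset.mul_sum]
  refine Finset.sum_congr rfl fun z _ => ?_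
  have h : (fun j : Fin (m + 1) => kuhnVertex
      ((Equiv.addRight (fun i => if σ i = 0 then (1 : R) else 0)) z)
      ((finRotate (m + 1))⁻¹ * σ) (j : ℕ)) = fun j : Fin (m + 1) => kuhnVertex z σ (j + 1) := by
    funext j
    exact kuhnVertex_rotate z σ (Nat.lt_succ_iff.mp j.2)
  simp only [Equiv.coe_mulLeft]
  rw [h, Equiv.Perm.sign_mul, Equiv.Perm.sign_inv, sign_finRotate]
  push_cast
  rw [← mul_assoc, ← mul_assoc, ← pow_add, Even.neg_one_pow ⟨m, by simp⟩, one_mul]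

/-- Discrete Stokes theorem on the Kuhn triangulation of a torus. -/
lemma sum_kuhnVertex_faces {R : Type*} [AddCommGroup R] [One R] [Fintype R] {m : ℕ}
    (g : (Fin (m + 1) → Fin (m + 1) → R) → ℤ) :
    ∑ z : Fin (m + 1) → R, ∑ σ : Equiv.Perm (Fin (m + 1)), (Equiv.Perm.sign σ : ℤ) *
      ∑ k : Fin (m + 2), (-1) ^ (k : ℕ) *
        g (fun j => kuhnVertex z σ (k.succAbove j : Fin (m + 2))) = 0 := by
  have h1 : ∀ z : Fin (m + 1) → R, ∑ σ : Equiv.Perm (Fin (m + 1)), (Equiv.Perm.sign σ : ℤ) *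
      ∑ k : Fin (m + 2), (-1) ^ (k : ℕ) *
        g (fun j => kuhnVertex z σ (k.succAbove j : Fin (m + 2))) =
      ∑ k : Fin (m + 2), (-1) ^ (k : ℕ) * ∑ σ : Equiv.Perm (Fin (m + 1)),
        (Equiv.Perm.sign σ : ℤ) *
          g (fun j => kuhnVertex z σ (k.succAbove j : Fin (m + 2))) := by
    intro z
    simp only [Finset.mul_sum]
    rw [Finset.sum_comm]
    exact Finset.sum_congr rfl fun _ _ => Finset.sum_congr rfl fun _ _ => by ring
  simp only [h1]
  have h2 : ∀ z : Fin (m + 1) → R, ∑ k : Fin (m + 2), (-1) ^ (k : ℕ) *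
      ∑ σ : Equiv.Perm (Fin (m + 1)), (Equiv.Perm.sign σ : ℤ) *
          g (fun j => kuhnVertex z σ (k.succAbove j : Fin (m + 2))) =
      ∑ σ : Equiv.Perm (Fin (m + 1)), (Equiv.Perm.sign σ : ℤ) *
          g (fun j => kuhnVertex z σ (j + 1)) +
      (-1) ^ (m + 1) * ∑ σ : Equiv.Perm (Fin (m + 1)), (Equiv.Perm.sign σ : ℤ) *
          g (fun j => kuhnVertex z σ j) := by
    intro z
    rw [Fin.sum_univ_succ, Fin.sum_univ_castSucc]
    have h3 : ∑ i : Fin m, (-1) ^ ((i.castSucc.succ : Fin (m + 2)) : ℕ) *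
        ∑ σ : Equiv.Perm (Fin (m + 1)), (Equiv.Perm.sign σ : ℤ) *
          g (fun j => kuhnVertex z σ (i.castSucc.succ.succAbove j : Fin (m + 2))) = 0 :=
      Finset.sum_eq_zero fun i _ => by rw [sum_kuhnVertex_inner_face, mul_zero]
    rw [h3]
    simp
  simp only [h2]
  rw [Finset.sum_add_distrib, sum_kuhnVertex_outer_face, ← Finset.mul_sum, ← add_mul, pow_succ]
  ring

/-- The matrix whose rows are the homogeneous coordinates of the images under `a` of the vertices
of a Kuhn simplex. -/
def kuhnMatrix {R : Type*} [Add R] [Zero R] [One R] {n : ℕ} (a : Fin n → (Fin n → R) → ℤ)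
    (z : Fin n → R) (σ : Equiv.Perm (Fin n)) : Matrix (Fin (n + 1)) (Fin (n + 1)) ℤ :=
  Matrix.of fun k j => Fin.cases 1 (fun i => a i (kuhnVertex z σ k)) j

lemma sum_det_kuhnMatrix {R : Type*} [AddCommGroup R] [One R] [Fintype R] {m : ℕ}
    (a : Fin (m + 1) → (Fin (m + 1) → R) → ℤ) :
    ∑ z : Fin (m + 1) → R, ∑ σ : Equiv.Perm (Fin (m + 1)), (Equiv.Perm.sign σ : ℤ) *
      (kuhnMatrix a z σ).det = 0 := by
  rw [← sum_kuhnVertex_faces (R := R) (fun w => (Matrix.of fun k j => a j (w k)).det)]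
  refine Finset.sum_congr rfl fun z _ => Finset.sum_congr rfl fun σ _ => ?_
  rw [Matrix.det_succ_column_zero]
  congr 1
  refine Finset.sum_congr rfl fun k _ => ?_
  simp [kuhnMatrix, Matrix.submatrix]

lemma det_kuhnMatrix_eq_zero {R : Type*} [Add R] [Zero R] [One R] {n : ℕ}
    (a : Fin n → (Fin n → R) → ℤ) (z : Fin n → R) (σ : Equiv.Perm (Fin n)) (i : Fin n) (c : ℤ)
    (h : ∀ k ≤ n, a i (kuhnVertex z σ k) = c) : (kuhnMatrix a z σ).det = 0 := by
  refine (Matrix.exists_mulVec_eq_zero_iff.mp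
    ⟨Pi.single i.succ 1 + Pi.single 0 (-c), ?_, ?_⟩)
  · intro h0
    have := congrFun h0 i.succ
    simp [Fin.succ_ne_zero] at this
  · funext k
    simp [Matrix.mulVec_add, kuhnMatrix, h k (Nat.lt_succ_iff.mp k.2)]

lemma det_kuhnMatrix_of_step {R : Type*} [Add R] [Zero R] [One R] {n : ℕ}
    (a : Fin n → (Fin n → R) → ℤ) (z : Fin n → R) (σ : Equiv.Perm (Fin n))
    (h : ∀ i, ∀ k ≤ n, a i (kuhnVertex z σ k) = if (σ i : ℕ) < k then 1 else 0) :
    (kuhnMatrix a z σ).det = Equiv.Perm.sign σ := by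
  let L : Matrix (Fin (n + 1)) (Fin (n + 1)) ℤ := Matrix.of fun k j => if j ≤ k then 1 else 0
  have hL : L.det = 1 := by
    rw [Matrix.det_of_isLowerTriangular L]
    · simp [L]
    · intro i j hij
      have : ¬ j ≤ i := not_le.mpr (OrderDual.toDual_lt_toDual.mp hij)
      simp [L, this]
  have hM : kuhnMatrix a z σ = L.submatrix id (Equiv.Perm.decomposeFin.symm (0, σ)) := by
    ext k j
    rw [Matrix.submatrix_apply]
    refine Fin.cases ?_ (fun i => ?_) j
    · simp only [kuhnMatrix, L, Matrix.of_apply]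
      simp
    · simp only [kuhnMatrix, L, Matrix.of_apply, Equiv.Perm.decomposeFin_symm_apply_succ,
        Equiv.swap_self, Equiv.refl_apply, id, Fin.cases_succ, h i k (Nat.lt_succ_iff.mp k.2)]
      exact if_congr (by rw [Fin.le_def, Fin.val_succ, Nat.succ_le_iff]) rfl rfl
  rw [hM, Matrix.det_permute', hL]
  simp

lemma val_kuhnVertex_of_lt {M n : ℕ} [Fact (1 < M)] (z : Fin n → ZMod M)
    (σ : Equiv.Perm (Fin n)) (k : ℕ) (j : Fin n) (h : (z j).val + 1 < M) :
    (kuhnVertex z σ k j).val = (z j).val + if (σ j : ℕ) < k then 1 else 0 := by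
  unfold kuhnVertex
  split_ifs
  · rw [ZMod.val_add_of_lt] <;> rw [ZMod.val_one]
    exact h
  · simp

lemma kuhnVertex_of_val_add_one_eq {M n : ℕ} [NeZero M] (z : Fin n → ZMod M)
    (σ : Equiv.Perm (Fin n)) (k : ℕ) (j : Fin n) (h : (z j).val + 1 = M) :
    (kuhnVertex z σ k j).val = 0 ∨ (kuhnVertex z σ k j).val + 1 = M := by
  unfold kuhnVertex
  split_ifs
  · left
    rw [← ZMod.natCast_zmod_val (z j)]
    have : (((z j).val + 1 : ℕ) : ZMod M) = 0 := by rw [h]; simp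
    push_cast at this
    rw [this, ZMod.val_zero]
  · right
    rwa [add_zero]

/-- A discrete Poincaré–Miranda theorem on a cubical grid. -/
theorem exists_cell_of_separated_faces (m N : ℕ) (hN : 1 ≤ N)
    (P : Fin (m + 1) → (Fin (m + 1) → ℕ) → Prop)
    (h0 : ∀ i x, x i = 1 → ¬ P i x) (h1 : ∀ i x, x i = N + 1 → P i x) :
    ∃ z : Fin (m + 1) → ℕ, (∀ j, 1 ≤ z j ∧ z j ≤ N) ∧
      ∀ i, ∃ x y : Fin (m + 1) → ℕ, (∀ j, z j ≤ x j ∧ x j ≤ z j + 1) ∧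
        (∀ j, z j ≤ y j ∧ y j ≤ z j + 1) ∧ P i x ∧ ¬ P i y := by
  classical
  by_contra hcon
  push Not at hcon
  have : Fact (1 < N + 3) := ⟨by omega⟩
  let std : Fin (m + 1) → (Fin (m + 1) → ZMod (N + 3)) → ℤ :=
    fun i x => if 2 ≤ (x i).val then 1 else 0
  let a : Fin (m + 1) → (Fin (m + 1) → ZMod (N + 3)) → ℤ := fun i x =>
    if ∃ j, (x j).val = 0 ∨ (x j).val + 1 = N + 3 then std i x
    else if P i (fun j => (x j).val) then 1 else 0
  have hseam : ∀ z, (∃ j, (z j).val + 1 = N + 3) → ∀ σ, kuhnMatrix a z σ = kuhnMatrix std z σ := by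
    rintro z ⟨j, hj⟩ σ
    ext k l
    refine Fin.cases rfl (fun i => ?_) l
    exact if_pos ⟨j, kuhnVertex_of_val_add_one_eq z σ k j hj⟩
  have hbox : ∀ z, (¬ ∃ j, (z j).val + 1 = N + 3) → ∀ σ, (kuhnMatrix a z σ).det = 0 := by
    intro z hz σ
    push Not at hz
    have hlt : ∀ j, (z j).val + 1 < N + 3 := fun j =>
      lt_of_le_of_ne (ZMod.val_lt (z j)) (hz j)
    have hv := fun k j => val_kuhnVertex_of_lt z σ k j (hlt j)
    by_cases hlow : ∃ i, (z i).val = 0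
    · obtain ⟨i, hi⟩ := hlow
      refine det_kuhnMatrix_eq_zero a z σ i 0 fun k _ => ?_
      have hvi := hv k i
      have hle : (kuhnVertex z σ k i).val ≤ 1 := by rw [hvi, hi]; split_ifs <;> simp
      by_cases hb : ∃ j, (kuhnVertex z σ k j).val = 0 ∨ (kuhnVertex z σ k j).val + 1 = N + 3
      · exact (if_pos hb).trans (if_neg (by omega))
      · refine (if_neg hb).trans (if_neg (h0 _ _ ?_))
        push Not at hb
        have := (hb i).1
        show (kuhnVertex z σ k i).val = 1
        omega
    by_cases hhigh : ∃ i, (z i).val = N + 1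
    · obtain ⟨i, hi⟩ := hhigh
      refine det_kuhnMatrix_eq_zero a z σ i 1 fun k _ => ?_
      have hvi := hv k i
      have hle : N + 1 ≤ (kuhnVertex z σ k i).val := by rw [hvi, hi]; simp
      have hlt' := ZMod.val_lt (kuhnVertex z σ k i)
      by_cases hb : ∃ j, (kuhnVertex z σ k j).val = 0 ∨ (kuhnVertex z σ k j).val + 1 = N + 3
      · exact (if_pos hb).trans (if_pos (by omega))
      · refine (if_neg hb).trans (if_pos (h1 _ _ ?_))
        push Not at hb
        have := (hb i).2
        show (kuhnVertex z σ k i).val = N + 1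
        omega
    push Not at hlow hhigh
    have hz' : ∀ j, 1 ≤ (z j).val ∧ (z j).val ≤ N := fun j => by
      have := hlow j; have := hhigh j; have := hlt j
      omega
    have hcell : ∀ k j, (z j).val ≤ (kuhnVertex z σ k j).val ∧
        (kuhnVertex z σ k j).val ≤ (z j).val + 1 := fun k j => by
      rw [hv]; split_ifs <;> simp
    have hb : ∀ k, ¬ ∃ j, (kuhnVertex z σ k j).val = 0 ∨
        (kuhnVertex z σ k j).val + 1 = N + 3 := by
      rintro k ⟨j, hj⟩
      have := hcell k j; have := hz' j
      omega
    obtain ⟨i, hi⟩ := hcon (fun j => (z j).val) hz'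
    by_cases hP : P i (fun j => (kuhnVertex z σ 0 j).val)
    · exact det_kuhnMatrix_eq_zero a z σ i 1 fun k _ =>
        (if_neg (hb k)).trans (if_pos (hi _ _ (hcell 0) (hcell k) hP))
    · exact det_kuhnMatrix_eq_zero a z σ i 0 fun k _ =>
        (if_neg (hb k)).trans (if_neg fun hk => hP (hi _ _ (hcell k) (hcell 0) hk))
  have hstd : ∀ z, (¬ ∃ j, (z j).val + 1 = N + 3) → z ≠ (fun _ => 1) →
      ∀ σ, (kuhnMatrix std z σ).det = 0 := by
    intro z hz hne σ
    push Not at hz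
    obtain ⟨i, hi⟩ := Function.ne_iff.mp hne
    have hi' : (z i).val ≠ 1 := fun h => hi (ZMod.val_injective _ (by rw [h, ZMod.val_one]))
    have hv := fun k => val_kuhnVertex_of_lt z σ k i (lt_of_le_of_ne (ZMod.val_lt (z i)) (hz i))
    by_cases h : (z i).val = 0
    · refine det_kuhnMatrix_eq_zero std z σ i 0 fun k _ => if_neg ?_
      rw [hv, h]; split_ifs <;> simp
    · refine det_kuhnMatrix_eq_zero std z σ i 1 fun k _ => if_pos ?_
      rw [hv]; omega
  have hone : ∀ σ, (kuhnMatrix std (fun _ => 1) σ).det = Equiv.Perm.sign σ := by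
    intro σ
    refine det_kuhnMatrix_of_step std _ σ fun i k _ => ?_
    have hv := val_kuhnVertex_of_lt (fun _ => (1 : ZMod (N + 3))) σ k i
      (by rw [ZMod.val_one]; omega)
    simp only [ZMod.val_one] at hv
    by_cases h : (σ i : ℕ) < k
    · rw [if_pos h] at hv ⊢
      exact if_pos (by omega)
    · rw [if_neg h] at hv ⊢
      exact if_neg (by omega)
  have hdiff : ∑ z : Fin (m + 1) → ZMod (N + 3), ∑ σ : Equiv.Perm (Fin (m + 1)),
      ((Equiv.Perm.sign σ : ℤ) * (kuhnMatrix std z σ).det -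
        (Equiv.Perm.sign σ : ℤ) * (kuhnMatrix a z σ).det) = 0 := by
    simp only [Finset.sum_sub_distrib, sum_det_kuhnMatrix, sub_self]
  have hno : ¬ ∃ j : Fin (m + 1), ((fun _ => 1 : Fin (m + 1) → ZMod (N + 3)) j).val + 1 = N + 3 := by
    rintro ⟨_, hj⟩
    rw [ZMod.val_one] at hj
    omega
  rw [Finset.sum_eq_single (fun _ => 1)] at hdiff
  · simp only [hone, hbox _ hno, mul_zero, sub_zero, ← Units.val_mul, Int.units_mul_self] at hdiff
    simp [Fintype.card_perm, Nat.factorial_ne_zero] at hdiff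
  · intro z _ hz
    refine Finset.sum_eq_zero fun σ _ => ?_
    by_cases hs : ∃ j, (z j).val + 1 = N + 3
    · rw [hseam z hs, sub_self]
    · rw [hbox z hs, hstd z hs hz, sub_self]
  · simp

lemma exists_seq_of_reflTransGen {α : Type*} {Q : α → Prop} {R : α → α → Prop} {u w : α}
    (hu : Q u) (h : Relation.ReflTransGen (fun x y => Q y ∧ R x y) u w) :
    ∃ (k : ℕ) (p : ℕ → α), p 0 = u ∧ p k = w ∧ (∀ l ≤ k, Q (p l)) ∧
      ∀ l < k, R (p l) (p (l + 1)) := by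
  induction h using Relation.ReflTransGen.head_induction_on with
  | refl => exact ⟨0, fun _ => w, rfl, rfl, fun _ _ => hu, fun l hl => absurd hl (Nat.not_lt_zero l)⟩
  | @head a b hab _ ih =>
    obtain ⟨k, p, hp0, hpk, hQ, hR⟩ := ih hab.1
    refine ⟨k + 1, fun l => Nat.casesOn l a p, rfl, hpk, fun l hl => ?_, fun l hl => ?_⟩
    · cases l with
      | zero => exact hu
      | succ l => exact hQ l (Nat.le_of_succ_le_succ hl)
    · cases l with
      | zero => simpa [hp0] using hab.2
      | succ l => exact hR l (Nat.lt_of_succ_lt_succ hl)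

/-- A Hex-type theorem: if the points of a grid of dimension `m + 1` are coloured by the coordinate
directions, then some colour contains a long chain in its own direction. -/
theorem exists_monochromatic_chain (m N : ℕ) (hN : 1 ≤ N)
    (c : (Fin (m + 1) → ℕ) → Fin (m + 1)) :
    ∃ (i : Fin (m + 1)) (k : ℕ) (p : ℕ → Fin (m + 1) → ℕ), p 0 i ≤ 2 ∧ N ≤ p k i ∧
      (∀ l ≤ k, c (p l) = i) ∧
      ∀ l < k, ∀ j, p l j ≤ p (l + 1) j + 2 ∧ p (l + 1) j ≤ p l j + 2 := by
  by_contra hcon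
  let near : (Fin (m + 1) → ℕ) → (Fin (m + 1) → ℕ) → Prop :=
    fun x y => ∀ j, x j ≤ y j + 2 ∧ y j ≤ x j + 2
  let reach : Fin (m + 1) → (Fin (m + 1) → ℕ) → Prop := fun i w =>
    ∃ u, c u = i ∧ u i ≤ 2 ∧ Relation.ReflTransGen (fun x y => c y = i ∧ near x y) u w
  have hreach : ∀ i w, reach i w → w i < N := by
    rintro i w ⟨u, hu, hu2, huw⟩
    by_contra! hw
    obtain ⟨k, p, rfl, rfl, hQ, hR⟩ := exists_seq_of_reflTransGen (Q := fun x => c x = i) hu huw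
    exact hcon ⟨i, k, p, hu2, hw, hQ, hR⟩
  obtain ⟨z, -, hz⟩ := exists_cell_of_separated_faces m N hN
    (fun i x => ¬ (x i = 1 ∨ ∃ w, (∀ j, x j ≤ w j + 1 ∧ w j ≤ x j + 1) ∧ reach i w))
    (fun i x hx => not_not.mpr (Or.inl hx))
    (fun i x hx => by
      rintro (h | ⟨w, hw, hr⟩)
      · omega
      · have := hreach i w hr; have := hw i
        omega)
  obtain ⟨x, y, hx, hy, hPx, hPy⟩ := hz (c z)
  refine hPx (Or.inr ⟨z, fun j => ⟨(hx j).2, by have := (hx j).1; omega⟩, ?_⟩)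
  rcases not_not.mp hPy with h | ⟨w, hw, u, hu, hu2, huw⟩
  · exact ⟨z, rfl, by have := (hy (c z)).1; omega, Relation.ReflTransGen.refl⟩
  · refine ⟨u, hu, hu2, huw.tail ⟨rfl, fun j => ?_⟩⟩
    have := hw j; have := hy j
    omega

/-- The `m + 1` diagonal translates of the family of shrunken unit cubes cover `ℝ^m`. -/
lemma exists_shifted_cube_family (m : ℕ) (y : Fin m → ℝ) :
    ∃ j : Fin (m + 1), ∀ i, 1 / (4 * (m + 1) : ℝ) ≤ Int.fract (y i - j / (m + 1)) ∧
      Int.fract (y i - j / (m + 1)) ≤ 1 - 1 / (4 * (m + 1) : ℝ) := by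
  by_contra! hcon
  have hm : (0 : ℝ) < m + 1 := by positivity
  have hclose : ∀ j : Fin (m + 1), ∃ i, ∃ b : ℤ,
      |y i - j / (m + 1) - b| ≤ 1 / (4 * (m + 1) : ℝ) := by
    intro j
    obtain ⟨i, hi⟩ := hcon j
    have hf := Int.self_sub_floor (y i - j / (m + 1))
    have hf0 := Int.fract_nonneg (y i - j / (m + 1))
    have hf1 := Int.fract_lt_one (y i - j / (m + 1))
    by_cases h : 1 / (4 * (m + 1) : ℝ) ≤ Int.fract (y i - j / (m + 1))
    · refine ⟨i, ⌊y i - j / (m + 1)⌋ + 1, ?_⟩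
      have := hi h
      push_cast
      rw [abs_le]
      constructor <;> linarith
    · refine ⟨i, ⌊y i - j / (m + 1)⌋, ?_⟩
      rw [hf, abs_of_nonneg hf0]
      exact (not_le.mp h).le
  choose i b hb using hclose
  obtain ⟨j, j', hne, hij⟩ := Fintype.exists_ne_map_eq_of_card_lt i (by simp)
  have hj := hb j
  have hj' := hb j'
  rw [← hij] at hj'
  have hq : 1 / (4 * (m + 1) : ℝ) * (m + 1) = 1 / 4 := by field_simp
  have hdiv : ∀ j : Fin (m + 1), ((j : ℕ) / (m + 1) : ℝ) * (m + 1) = (j : ℕ) := fun j =>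
    div_mul_cancel₀ _ hm.ne'
  have hlt : |((j : ℤ) - j' - (m + 1) * (b j' - b j) : ℤ)| < (1 : ℤ) := by
    have : |(((j : ℤ) - j' - (m + 1) * (b j' - b j) : ℤ) : ℝ)| < 1 := by
      push_cast
      rw [abs_le] at hj hj'
      have e1 := mul_le_mul_of_nonneg_right hj.1 hm.le
      have e2 := mul_le_mul_of_nonneg_right hj.2 hm.le
      have e3 := mul_le_mul_of_nonneg_right hj'.1 hm.le
      have e4 := mul_le_mul_of_nonneg_right hj'.2 hm.le
      have d1 := hdiv j
      have d2 := hdiv j'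
      rw [abs_lt]
      constructor <;> nlinarith
    exact_mod_cast this
  have h0 := Int.abs_lt_one_iff.mp hlt
  have hjlt := j.2
  have hjlt' := j'.2
  have hbb : b j' - b j = 0 := by
    rcases lt_trichotomy (b j' - b j) 0 with h | h | h
    · nlinarith
    · exact h
    · nlinarith
  rw [hbb] at h0
  exact hne (Fin.ext (by omega))

lemma floor_eq_of_fract_mem {η s t : ℝ} (hs : η ≤ Int.fract s ∧ Int.fract s ≤ 1 - η)
    (ht : η ≤ Int.fract t ∧ Int.fract t ≤ 1 - η) (hst : |s - t| < 2 * η) : ⌊s⌋ = ⌊t⌋ := by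
  have key : ∀ {s t : ℝ}, Int.fract s ≤ 1 - η → η ≤ Int.fract t → |s - t| < 2 * η →
      ⌊t⌋ ≤ ⌊s⌋ := by
    intro s t hs ht hst
    by_contra! h
    have h' : (⌊s⌋ : ℝ) + 1 ≤ ⌊t⌋ := by exact_mod_cast h
    have := Int.self_sub_floor s
    have := Int.self_sub_floor t
    have := (abs_lt.mp hst).1
    linarith
  exact le_antisymm (key ht.2 hs.1 (by rwa [abs_sub_comm])) (key hs.2 ht.1 hst)

lemma norm_le_sum_abs {n : ℕ} (x : EuclideanSpace ℝ (Fin n)) : ‖x‖ ≤ ∑ i, |x i| := by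
  conv_lhs => rw [← (EuclideanSpace.basisFun (Fin n) ℝ).sum_repr x]
  refine (norm_sum_le _ _).trans (Finset.sum_le_sum fun i _ => ?_)
  rw [norm_smul]
  simp

theorem not_lipschitzLightWithD_snowflake {ε C : ℝ} (hε : 0 < ε) (hC : 0 < C) (m : ℕ)
    (f : EuclideanSpace ℝ (Fin (m + 1)) → EuclideanSpace ℝ (Fin m)) :
    ¬ LipschitzLightWithD (fun x y => ‖x - y‖ ^ ε) dist C f := by
  rintro ⟨hlip, hlight⟩
  have hm : (0 : ℝ) < m + 1 := by positivity
  obtain ⟨τ, hτ0, hτ1, hτC⟩ : ∃ τ : ℝ, 0 < τ ∧ τ ≤ 1 ∧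
      (m + 1) * (C * τ) < 2 * (1 / (4 * (m + 1))) := by
    refine ⟨min 1 (1 / (4 * (m + 1) * (m + 1) * C)), by positivity, min_le_left _ _, ?_⟩
    calc (m + 1) * (C * min 1 (1 / (4 * (m + 1) * (m + 1) * C)))
        ≤ (m + 1) * (C * (1 / (4 * (m + 1) * (m + 1) * C))) := by gcongr; exact min_le_right _ _
      _ = 1 / (4 * (m + 1)) := by field_simp
      _ < 2 * (1 / (4 * (m + 1))) := lt_two_mul_self (by positivity)
  obtain ⟨h, hh0, hh⟩ : ∃ h : ℝ, 0 < h ∧ ((m + 1) * (2 * h)) ^ ε = τ := by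
    refine ⟨τ ^ ε⁻¹ / (2 * (m + 1)), by positivity, ?_⟩
    rw [show (m + 1) * (2 * (τ ^ ε⁻¹ / (2 * (m + 1)))) = τ ^ ε⁻¹ by field_simp,
      Real.rpow_inv_rpow hτ0.le hε.ne']
  obtain ⟨N, hN⟩ := exists_nat_gt (C ^ ε⁻¹ / h + 2)
  have hN2 : 2 < (N : ℝ) := lt_of_le_of_lt (le_add_of_nonneg_left (by positivity)) hN
  let φ : (Fin (m + 1) → ℕ) → EuclideanSpace ℝ (Fin (m + 1)) :=
    fun x => WithLp.toLp 2 fun j => h * x j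
  choose c hc using fun x => exists_shifted_cube_family m (fun i => (m + 1) * f (φ x) i)
  obtain ⟨i, k, p, hp0, hpk, hcol, hstep⟩ := exists_monochromatic_chain m N
    (by exact_mod_cast (by linarith : (1 : ℝ) ≤ N)) c
  have hstep' : ∀ l < k, ‖φ (p l) - φ (p (l + 1))‖ ^ ε ≤ τ := by
    intro l hl
    rw [← hh]
    refine Real.rpow_le_rpow (norm_nonneg _) ?_ hε.le
    refine (norm_le_sum_abs _).trans ?_
    calc ∑ j, |(φ (p l) - φ (p (l + 1))) j| ≤ ∑ _j : Fin (m + 1), 2 * h := by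
          refine Finset.sum_le_sum fun j _ => ?_
          have h1 : (p l j : ℝ) ≤ p (l + 1) j + 2 := by exact_mod_cast (hstep l hl j).1
          have h2 : (p (l + 1) j : ℝ) ≤ p l j + 2 := by exact_mod_cast (hstep l hl j).2
          have : (φ (p l) - φ (p (l + 1))) j = h * (p l j - p (l + 1) j) := by
            simp [φ, mul_sub]
          rw [this, abs_mul, abs_of_pos hh0, mul_comm]
          gcongr
          rw [abs_le]
          constructor <;> linarith
      _ = (m + 1) * (2 * h) := by simp
  have hfloor : ∀ l ≤ k, ∀ j, ⌊(m + 1) * f (φ (p l)) j - (i : ℕ) / (m + 1)⌋ =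
      ⌊(m + 1) * f (φ (p 0)) j - (i : ℕ) / (m + 1)⌋ := by
    intro l
    induction l with
    | zero => exact fun _ _ => rfl
    | succ l ih =>
      intro hl j
      rw [← ih (by omega) j]
      have g1 := hc (p (l + 1)) j
      have g2 := hc (p l) j
      rw [hcol _ hl] at g1
      rw [hcol _ (by omega)] at g2
      refine (floor_eq_of_fract_mem g2 g1 (lt_of_le_of_lt ?_ hτC)).symm
      rw [sub_sub_sub_cancel_right, ← mul_sub, abs_mul, abs_of_pos hm]
      gcongr
      refine le_trans ?_ ((hlip _ _).trans (mul_le_mul_of_nonneg_left (hstep' l (by omega)) hC.le))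
      rw [dist_eq_norm]
      exact PiLp.norm_apply_le (f (φ (p l)) - f (φ (p (l + 1)))) j
  have hdiam : ∀ w ∈ {w | ∃ l ≤ k, f (φ (p l)) = w}, ∀ w' ∈ {w | ∃ l ≤ k, f (φ (p l)) = w},
      dist w w' ≤ 1 := by
    rintro _ ⟨l, hl, rfl⟩ _ ⟨l', hl', rfl⟩
    rw [dist_eq_norm]
    refine (norm_le_sum_abs _).trans ?_
    calc ∑ j, |(f (φ (p l)) - f (φ (p l'))) j| ≤ ∑ _j : Fin m, 1 / (m + 1 : ℝ) := by
          refine Finset.sum_le_sum fun j _ => ?_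
          have := Int.abs_sub_lt_one_of_floor_eq_floor
            ((hfloor l hl j).trans (hfloor l' hl' j).symm)
          rw [sub_sub_sub_cancel_right, ← mul_sub, abs_mul, abs_of_pos hm] at this
          rw [le_div_iff₀' hm]
          exact this.le
      _ ≤ 1 := by
          simp only [Finset.sum_const, Finset.card_univ, Fintype.card_fin, nsmul_eq_mul]
          rw [mul_one_div, div_le_one hm]
          linarith
  have hfinal := hlight 1 one_pos _ hdiam k (fun l => φ (p l)) (fun l hl => ⟨l, hl, rfl⟩)
    (fun l hl => (hstep' l hl).trans hτ1) k le_rfl 0 (Nat.zero_le k)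
  have hp0' : (p 0 i : ℝ) ≤ 2 := by exact_mod_cast hp0
  have hpk' : (N : ℝ) ≤ p k i := by exact_mod_cast hpk
  have hbig : C ^ ε⁻¹ < ‖φ (p k) - φ (p 0)‖ := by
    calc C ^ ε⁻¹ = h * (C ^ ε⁻¹ / h) := by field_simp
      _ < h * (p k i - p 0 i) := by gcongr; linarith
      _ = (φ (p k) - φ (p 0)) i := by simp [φ, mul_sub]
      _ ≤ ‖φ (p k) - φ (p 0)‖ :=
        (le_abs_self _).trans (PiLp.norm_apply_le (φ (p k) - φ (p 0)) i)
  have := Real.rpow_lt_rpow (by positivity) hbig hε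
  rw [Real.rpow_inv_rpow hC.le hε.ne'] at this
  simp only [mul_one] at hfinal
  linarith

lemma abs_sub_round_lipschitz (x y : ℝ) : |(|x - round x| - |y - round y|)| ≤ |x - y| := by
  have key : ∀ x y : ℝ, |x - round x| ≤ |x - y| + |y - round y| := fun x y =>
    (round_le x (round y)).trans (abs_sub_le x y _)
  have h1 := key x y
  have h2 := key y x
  rw [abs_sub_comm y x] at h2
  rw [abs_le]
  constructor <;> linarith

lemma abs_sub_round_int_add_half (q : ℤ) :
    |((q : ℝ) + 1 / 2) - round ((q : ℝ) + 1 / 2)| = 1 / 2 := by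
  rw [round_eq, add_assoc, show (1 / 2 : ℝ) + 1 / 2 = ((1 : ℤ) : ℝ) by norm_num, ← Int.cast_add,
    Int.floor_intCast]
  push_cast
  rw [show (q : ℝ) + 1 / 2 - (q + 1) = -(1 / 2) by ring, abs_neg, abs_of_pos (by norm_num)]

/-- The `k`-th term of a two-sided Takagi–Weierstrass series. -/
noncomputable def takagiTerm (α lam : ℝ) (k : ℤ) (x : ℝ) : ℝ :=
  α ^ (-k) * |lam ^ k * x - round (lam ^ k * x)|

lemma abs_takagiTerm_sub_le {α lam : ℝ} (hα : 0 < α) (hlam : 0 < lam) (k : ℤ) (x y : ℝ) :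
    |takagiTerm α lam k x - takagiTerm α lam k y| ≤ α ^ (-k) * min 1 (lam ^ k * |x - y|) := by
  have hk : 0 < lam ^ k := zpow_pos hlam k
  rw [takagiTerm, takagiTerm, ← mul_sub, abs_mul, abs_of_pos (zpow_pos hα _)]
  refine mul_le_mul_of_nonneg_left (le_min ?_ ?_) (zpow_pos hα _).le
  · have h1 := abs_sub_round (lam ^ k * x)
    have h2 := abs_sub_round (lam ^ k * y)
    have h3 := abs_nonneg (lam ^ k * x - round (lam ^ k * x))
    have h4 := abs_nonneg (lam ^ k * y - round (lam ^ k * y))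
    rw [abs_le]
    constructor <;> linarith
  · refine (abs_sub_round_lipschitz _ _).trans_eq ?_
    rw [← mul_sub, abs_mul, abs_of_pos hk]

lemma summable_zpow_neg_mul_min {α lam : ℝ} (hα : 1 < α) (hlam : α < lam) :
    Summable fun j : ℤ => α ^ (-j) * min 1 (lam ^ j) := by
  have hα0 : 0 < α := by linarith
  have hlam0 : 0 < lam := by linarith
  refine Summable.of_nat_of_neg ?_ ?_
  · refine Summable.of_nonneg_of_le (fun n => by positivity) (fun n => ?_)
      (summable_geometric_of_lt_one (inv_nonneg.mpr hα0.le) (inv_lt_one_of_one_lt₀ hα))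
    refine (mul_le_of_le_one_right (by positivity) (min_le_left _ _)).trans_eq ?_
    simp
  · refine Summable.of_nonneg_of_le (fun n => by positivity) (fun n => ?_)
      (summable_geometric_of_lt_one (div_nonneg hα0.le hlam0.le) ((div_lt_one hlam0).mpr hlam))
    refine (mul_le_mul_of_nonneg_left (min_le_right _ _) (by positivity)).trans_eq ?_
    simp [mul_pow, div_eq_mul_inv]

/-- The scale-`n` form of the Hölder bound for the Takagi–Weierstrass series. -/
lemma takagi_upper {α lam : ℝ} (hα : 1 < α) (hlam : α < lam) {x y : ℝ} {n : ℤ}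
    (hxy : |x - y| ≤ lam ^ n) :
    Summable (fun k => |takagiTerm α lam k x - takagiTerm α lam k y|) ∧
      ∑' k, |takagiTerm α lam k x - takagiTerm α lam k y| ≤
        α ^ n * ∑' j : ℤ, α ^ (-j) * min 1 (lam ^ j) := by
  have hα0 : 0 < α := by linarith
  have hlam0 : 0 < lam := by linarith
  have hs := ((Equiv.addRight n).summable_iff.mpr (summable_zpow_neg_mul_min hα hlam)).mul_left
    (α ^ n)
  have hle : ∀ k : ℤ, |takagiTerm α lam k x - takagiTerm α lam k y| ≤
      α ^ n * ((fun j : ℤ => α ^ (-j) * min 1 (lam ^ j)) ∘ Equiv.addRight n) k := by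
    intro k
    refine (abs_takagiTerm_sub_le hα0 hlam0 k x y).trans ?_
    simp only [Function.comp_apply, Equiv.coe_addRight]
    rw [← mul_assoc, ← zpow_add₀ hα0.ne', show n + -(k + n) = -k by ring, zpow_add₀ hlam0.ne']
    gcongr
  have hsum := Summable.of_nonneg_of_le (fun _ => abs_nonneg _) hle hs
  refine ⟨hsum, (hsum.tsum_le_tsum hle hs).trans_eq ?_⟩
  rw [tsum_mul_left]
  congr 1
  exact (Equiv.addRight n).tsum_eq (fun j : ℤ => α ^ (-j) * min 1 (lam ^ j))

lemma summable_takagiTerm {α lam : ℝ} (hα : 1 < α) (hlam : α < lam) (x : ℝ) :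
    Summable fun k => takagiTerm α lam k x := by
  obtain ⟨n, hn⟩ := pow_unbounded_of_one_lt |x - 0| (hα.trans hlam)
  have := (takagi_upper hα hlam (n := n) (by rw [zpow_natCast]; exact hn.le)).1
  exact this.of_abs.congr fun k => by simp [takagiTerm]

lemma abs_tsum_takagiTerm_sub_le {α lam : ℝ} (hα : 1 < α) (hlam : α < lam) {x y : ℝ} {n : ℤ}
    (hxy : |x - y| ≤ lam ^ n) :
    |∑' k, takagiTerm α lam k x - ∑' k, takagiTerm α lam k y| ≤
      α ^ n * ∑' j : ℤ, α ^ (-j) * min 1 (lam ^ j) := by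
  obtain ⟨hs, hle⟩ := takagi_upper hα hlam hxy
  rw [← (summable_takagiTerm hα hlam x).tsum_sub (summable_takagiTerm hα hlam y)]
  exact (tsum_of_norm_bounded hs.hasSum fun k => (Real.norm_eq_abs _).le).trans hle

lemma takagi_oscillation {α : ℝ} {p : ℕ} (hα : 1 < α) (hlam : 3 * α ≤ ((2 * p : ℕ) : ℝ))
    (k q : ℤ) :
    α ^ (-k) / 4 ≤ ∑' j, takagiTerm α ((2 * p : ℕ) : ℝ) j ((q + 1 / 2) * ((2 * p : ℕ) : ℝ) ^ (-k)) -
      ∑' j, takagiTerm α ((2 * p : ℕ) : ℝ) j (q * ((2 * p : ℕ) : ℝ) ^ (-k)) := by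
  set lam : ℝ := ((2 * p : ℕ) : ℝ) with hlamdef
  have hα0 : 0 < α := by linarith
  have hlt : α < lam := by linarith
  have hlam0 : 0 < lam := by linarith
  set x : ℝ := q * lam ^ (-k)
  set y : ℝ := (q + 1 / 2) * lam ^ (-k)
  have hyx : |y - x| = lam ^ (-k) / 2 := by
    rw [show y - x = lam ^ (-k) / 2 by simp only [x, y]; ring, abs_of_pos (by positivity)]
  set θ := α / lam
  have hθ0 : 0 < θ := div_pos hα0 hlam0
  have hθ : θ ≤ 1 / 3 := by
    rw [div_le_iff₀ hlam0]; linarith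
  have hscale : ∀ j : ℤ, lam ^ j * lam ^ (-k) = lam ^ (j - k) := fun j => by
    rw [← zpow_add₀ hlam0.ne', sub_eq_add_neg]
  have hhigh : ∀ j, k < j → takagiTerm α lam j y - takagiTerm α lam j x = 0 := by
    intro j hj
    obtain ⟨i, hi⟩ := Int.le.dest (Int.add_one_le_of_lt hj)
    have hpow : lam ^ j * lam ^ (-k) = ((2 * p * (2 * p) ^ i : ℤ) : ℝ) := by
      rw [hscale, show j - k = ((i + 1 : ℕ) : ℤ) by push_cast; linarith, zpow_natCast, pow_succ',
        hlamdef]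
      push_cast
      ring
    have hx : lam ^ j * x = ((q * (2 * p * (2 * p) ^ i) : ℤ) : ℝ) := by
      rw [Int.cast_mul, ← hpow]; ring
    have hy : lam ^ j * y = ((q * (2 * p * (2 * p) ^ i) + p * (2 * p) ^ i : ℤ) : ℝ) := by
      have : lam ^ j * y = (q + 1 / 2) * (lam ^ j * lam ^ (-k)) := by ring
      rw [this, hpow]
      push_cast
      ring
    rw [takagiTerm, takagiTerm, hx, hy, round_intCast, round_intCast]
    simp
  have hmid : takagiTerm α lam k y - takagiTerm α lam k x = α ^ (-k) / 2 := by
    have h1 : lam ^ k * lam ^ (-k) = 1 := by rw [hscale, sub_self, zpow_zero]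
    have hx : lam ^ k * x = (q : ℝ) := by
      rw [show lam ^ k * x = q * (lam ^ k * lam ^ (-k)) by ring, h1, mul_one]
    have hy : lam ^ k * y = (q : ℝ) + 1 / 2 := by
      rw [show lam ^ k * y = (q + 1 / 2) * (lam ^ k * lam ^ (-k)) by ring, h1, mul_one]
    rw [takagiTerm, takagiTerm, hx, hy, abs_sub_round_int_add_half, round_intCast]
    simp [div_eq_mul_inv]
  have hlow : ∀ i : ℕ, |takagiTerm α lam (k - 1 - i) y - takagiTerm α lam (k - 1 - i) x| ≤
      α ^ (-k) / 2 * θ * θ ^ i := by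
    intro i
    refine (abs_takagiTerm_sub_le hα0 hlam0 _ y x).trans ?_
    refine (mul_le_mul_of_nonneg_left (min_le_right _ _) (by positivity)).trans_eq ?_
    rw [hyx, mul_div_assoc', hscale, mul_assoc, ← pow_succ',
      show k - 1 - (i : ℤ) - k = -((i + 1 : ℕ) : ℤ) by push_cast; ring,
      show -(k - 1 - (i : ℤ)) = -k + ((i + 1 : ℕ) : ℤ) by push_cast; ring,
      zpow_add₀ hα0.ne', zpow_neg lam, zpow_natCast, zpow_natCast, div_pow]
    ring
  have hsy := summable_takagiTerm hα hlt y
  have hsx := summable_takagiTerm hα hlt x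
  rw [← hsy.tsum_sub hsx]
  have hs := hsy.sub hsx
  rw [hs.tsum_eq_add_tsum_ite k, hmid]
  have hrest : |∑' j, (if j = k then 0 else takagiTerm α lam j y - takagiTerm α lam j x)| ≤
      α ^ (-k) / 2 * θ * (1 - θ)⁻¹ := by
    have hinj : Function.Injective fun i : ℕ => k - 1 - (i : ℤ) := fun i j h => by
      simp only at h; omega
    have hsupp : Function.support (fun j => if j = k then 0 else
        takagiTerm α lam j y - takagiTerm α lam j x) ⊆ Set.range fun i : ℕ => k - 1 - (i : ℤ) := by
      intro j hj
      rw [Function.mem_support] at hj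
      have hjk : j < k := by
        rcases lt_trichotomy j k with h | h | h
        · exact h
        · exact absurd (if_pos h) hj
        · exact absurd ((if_neg h.ne').trans (hhigh j h)) hj
      exact ⟨(k - 1 - j).toNat, by simp only; omega⟩
    rw [← hinj.tsum_eq hsupp, ← Real.norm_eq_abs]
    refine tsum_of_norm_bounded
      ((hasSum_geometric_of_lt_one hθ0.le (by linarith)).mul_left _) fun i => ?_
    rw [if_neg (by omega), Real.norm_eq_abs]
    exact hlow i
  have hbound : θ * (1 - θ)⁻¹ ≤ 1 / 2 := by
    rw [← div_eq_mul_inv, div_le_iff₀ (by linarith)]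
    linarith
  have hαk : 0 < α ^ (-k) := zpow_pos hα0 _
  have := (abs_le.mp hrest).1
  have : α ^ (-k) / 2 * θ * (1 - θ)⁻¹ ≤ α ^ (-k) / 4 := by
    rw [mul_assoc]
    nlinarith
  linarith

/-- An `ε`-Hölder function on the line that oscillates by a multiple of `ℓ ^ ε` on every interval
of length `ℓ`. -/
theorem exists_holder_oscillating {ε : ℝ} (hε0 : 0 < ε) (hε1 : ε ≤ 1) :
    ∃ (f : ℝ → ℝ) (A c : ℝ), 0 < A ∧ 0 < c ∧ (∀ x y, |f x - f y| ≤ A * |x - y| ^ ε) ∧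
      ∀ a b, a < b → ∃ x ∈ Icc a b, ∃ y ∈ Icc a b, c * (b - a) ^ ε ≤ |f x - f y| := by
  rcases hε1.eq_or_lt with rfl | hε1
  · refine ⟨id, 1, 1, one_pos, one_pos, fun x y => by simp, fun a b hab =>
      ⟨b, right_mem_Icc.mpr hab.le, a, left_mem_Icc.mpr hab.le, ?_⟩⟩
    simpa using le_abs_self (b - a)
  obtain ⟨p, hp⟩ := exists_nat_gt ((3 : ℝ) ^ (1 - ε)⁻¹)
  have hp1 : (1 : ℝ) < p := (Real.one_le_rpow (by norm_num) (by
    rw [inv_nonneg]; linarith)).trans_lt hp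
  set lam : ℝ := ((2 * p : ℕ) : ℝ) with hlamdef
  have hlam2 : 2 * (p : ℝ) = lam := by rw [hlamdef]; push_cast; rfl
  have hlam0 : 0 < lam := by linarith
  have hlam1 : 1 < lam := by linarith
  set α : ℝ := lam ^ ε
  have hα : 1 < α := Real.one_lt_rpow hlam1 hε0
  have hα0 : 0 < α := by linarith
  have h3 : 3 * α ≤ lam := by
    have h : (3 : ℝ) ≤ lam ^ (1 - ε) := by
      have := Real.rpow_le_rpow (by positivity) (show (3 : ℝ) ^ (1 - ε)⁻¹ ≤ lam by linarith)
        (by linarith : 0 ≤ 1 - ε)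
      rwa [Real.rpow_inv_rpow (by norm_num) (by linarith)] at this
    calc 3 * α ≤ lam ^ (1 - ε) * α := by gcongr
      _ = lam := by
        rw [← Real.rpow_add hlam0, sub_add_cancel, Real.rpow_one]
  have hlt : α < lam := by linarith
  have hpow : ∀ n : ℤ, (lam ^ n) ^ ε = α ^ n := fun n => by
    rw [← Real.rpow_intCast, ← Real.rpow_intCast, ← Real.rpow_mul hlam0.le,
      ← Real.rpow_mul hlam0.le, mul_comm]
  set B := ∑' j : ℤ, α ^ (-j) * min 1 (lam ^ j)
  have hB : 0 ≤ B := tsum_nonneg fun j => by positivity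
  refine ⟨fun x => ∑' k, takagiTerm α lam k x, α * (B + 1), 1 / (4 * α ^ 2), by positivity,
    by positivity, fun x y => ?_, fun a b hab => ?_⟩
  · rcases eq_or_ne x y with rfl | hxy
    · simp only [sub_self, abs_zero]; positivity
    obtain ⟨n, hn, hn'⟩ := exists_mem_Ioc_zpow (abs_pos.mpr (sub_ne_zero.mpr hxy)) hlam1
    calc |∑' k, takagiTerm α lam k x - ∑' k, takagiTerm α lam k y|
        ≤ α ^ (n + 1) * B := abs_tsum_takagiTerm_sub_le hα hlt hn'
      _ = α * B * (lam ^ n) ^ ε := by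
          rw [hpow, zpow_add_one₀ hα0.ne']; ring
      _ ≤ α * (B + 1) * |x - y| ^ ε := by
          gcongr
          linarith
  · obtain ⟨n, hn, hn'⟩ := exists_mem_Ioc_zpow (sub_pos.mpr hab) hlam1
    have hosc := takagi_oscillation hα h3 (1 - n) ⌈a / lam ^ (n - 1)⌉
    rw [neg_sub] at hosc
    have hℓ : 0 < lam ^ (n - 1) := zpow_pos hlam0 _
    have htwo : 2 * lam ^ (n - 1) ≤ b - a := by
      have : lam ^ n = lam * lam ^ (n - 1) := by
        rw [← zpow_one_add₀ hlam0.ne']; congr 1; ring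
      nlinarith
    have hq1 : a ≤ ⌈a / lam ^ (n - 1)⌉ * lam ^ (n - 1) := by
      rw [← div_le_iff₀ hℓ]; exact Int.le_ceil _
    have hq2 : ⌈a / lam ^ (n - 1)⌉ * lam ^ (n - 1) ≤ a + lam ^ (n - 1) := by
      have := (Int.ceil_lt_add_one (a / lam ^ (n - 1))).le
      calc ⌈a / lam ^ (n - 1)⌉ * lam ^ (n - 1) ≤ (a / lam ^ (n - 1) + 1) * lam ^ (n - 1) := by
            gcongr
        _ = a + lam ^ (n - 1) := by field_simp
    refine ⟨_, ⟨?_, ?_⟩, _, ⟨hq1, by linarith⟩, le_trans ?_ (hosc.trans (le_abs_self _))⟩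
    · linarith
    · linarith
    · calc 1 / (4 * α ^ 2) * (b - a) ^ ε ≤ 1 / (4 * α ^ 2) * (lam ^ (n + 1)) ^ ε := by
            gcongr
        _ = α ^ (n - 1) / 4 := by
            rw [hpow, show n + 1 = n - 1 + 2 by ring, zpow_add₀ hα0.ne']
            field_simp

lemma exists_rpow_abs_sub_le_of_chain {ε r : ℝ} (hε : 0 < ε) (hr : 0 ≤ r) {k : ℕ} {p : ℕ → ℝ}
    (hp : ∀ l < k, |p l - p (l + 1)| ^ ε ≤ r) {i j : ℕ} (hi : i ≤ k) (hj : j ≤ k) {x : ℝ}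
    (hix : p i ≤ x) (hxj : x ≤ p j) : ∃ l ≤ k, |p l - x| ^ ε ≤ r := by
  by_contra! hcon
  have hne : ∀ l ≤ k, p l ≠ x := by
    rintro l hl rfl
    have := hcon l hl
    rw [sub_self, abs_zero, Real.zero_rpow hε.ne'] at this
    linarith
  have hside : ∀ l ≤ k, (p l < x ↔ p 0 < x) := by
    intro l
    induction l with
    | zero => exact fun _ => Iff.rfl
    | succ l ih =>
      intro hl
      rw [← ih (by omega)]
      have hfar : |p l - p (l + 1)| < |p l - x| := by
        by_contra! h
        have := Real.rpow_le_rpow (abs_nonneg _) h hε.le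
        linarith [hcon l (by omega), hp l hl]
      rcases (hne l (by omega)).lt_or_gt with h | h
      · refine iff_of_true ?_ h
        rw [abs_sub_comm (p l) x, abs_of_pos (by linarith : 0 < x - p l), abs_sub_comm] at hfar
        linarith [le_abs_self (p (l + 1) - p l)]
      · refine iff_of_false (not_lt.mpr ?_) (not_lt.mpr h.le)
        rw [abs_of_pos (by linarith : 0 < p l - x)] at hfar
        linarith [le_abs_self (p l - p (l + 1))]
  have h1 := (hside i hi).mp (hix.lt_of_ne (hne i hi))
  have h2 := (hside j hj).mpr h1
  linarith

lemma rpow_abs_sub_le_of_oscillating {ε A c : ℝ} (hε : 0 < ε) (hA : 0 < A) (hc : 0 < c)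
    {f : ℝ → ℝ} (hf : ∀ x y, |f x - f y| ≤ A * |x - y| ^ ε)
    (hosc : ∀ a b, a < b → ∃ x ∈ Icc a b, ∃ y ∈ Icc a b, c * (b - a) ^ ε ≤ |f x - f y|)
    {r : ℝ} (hr : 0 ≤ r) {k : ℕ} {p : ℕ → ℝ} (hp : ∀ l < k, |p l - p (l + 1)| ^ ε ≤ r)
    (hfp : ∀ i ≤ k, ∀ j ≤ k, |f (p i) - f (p j)| ≤ r) {i j : ℕ} (hi : i ≤ k) (hj : j ≤ k) :
    |p i - p j| ^ ε ≤ (1 + 2 * A) / c * r := by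
  wlog hij : p i ≤ p j generalizing i j
  · rw [abs_sub_comm]
    exact this hj hi (le_of_not_ge hij)
  rcases hij.eq_or_lt with h | h
  · rw [h, sub_self, abs_zero, Real.zero_rpow hε.ne']
    positivity
  obtain ⟨x, hx, y, hy, hxy⟩ := hosc _ _ h
  obtain ⟨l, hl, hlx⟩ := exists_rpow_abs_sub_le_of_chain hε hr hp hi hj hx.1 hx.2
  obtain ⟨l', hl', hly⟩ := exists_rpow_abs_sub_le_of_chain hε hr hp hi hj hy.1 hy.2
  have h1 := (hf (p l) x).trans (mul_le_mul_of_nonneg_left hlx hA.le)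
  have h2 := (hf (p l') y).trans (mul_le_mul_of_nonneg_left hly hA.le)
  have h3 := hfp l hl l' hl'
  rw [abs_sub_comm, abs_of_pos (sub_pos.mpr h), div_mul_eq_mul_div, le_div_iff₀ hc, mul_comm]
  refine hxy.trans ?_
  rw [abs_le] at h1 h2 h3 ⊢
  constructor <;> linarith [h1.1, h1.2, h2.1, h2.2, h3.1, h3.2]

theorem exists_lipschitzLightWithD_snowflake {ε : ℝ} (hε0 : 0 < ε) (hε1 : ε ≤ 1) {n : ℕ} :
    ∃ C > 0, ∃ f : EuclideanSpace ℝ (Fin n) → EuclideanSpace ℝ (Fin n),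
      LipschitzLightWithD (fun x y => ‖x - y‖ ^ ε) dist C f := by
  obtain ⟨f, A, c, hA, hc, hf, hosc⟩ := exists_holder_oscillating hε0 hε1
  set K := (1 + 2 * A) / c
  have hK : 0 < K := by positivity
  refine ⟨n * A + n ^ ε * K + 1, by positivity, fun x => WithLp.toLp 2 fun i => f (x i),
    fun x y => ?_, fun r hr W hW k p hpW hp i hi j hj => ?_⟩
  · rw [dist_eq_norm]
    refine (norm_le_sum_abs _).trans ?_
    calc ∑ i, |f (x i) - f (y i)| ≤ ∑ _i : Fin n, A * ‖x - y‖ ^ ε := by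
          refine Finset.sum_le_sum fun i _ => (hf _ _).trans ?_
          gcongr
          exact PiLp.norm_apply_le (x - y) i
      _ = n * A * ‖x - y‖ ^ ε := by simp [mul_assoc]
      _ ≤ (n * A + n ^ ε * K + 1) * ‖x - y‖ ^ ε := by
          gcongr
          rw [add_assoc]
          exact le_add_of_nonneg_right (by positivity)
  · have hcoord : ∀ s, |p i s - p j s| ≤ (K * r) ^ ε⁻¹ := by
      intro s
      rw [Real.le_rpow_inv_iff_of_pos (abs_nonneg _) (by positivity) hε0]
      refine rpow_abs_sub_le_of_oscillating (p := fun l => p l s) hε0 hA hc hf hosc hr.le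
        (fun l hl => ?_) (fun l hl l' hl' => ?_) hi hj
      · refine le_trans ?_ (hp l hl)
        exact Real.rpow_le_rpow (abs_nonneg _) (PiLp.norm_apply_le (p l - p (l + 1)) s) hε0.le
      · refine le_trans ?_ (hW _ (hpW l hl) _ (hpW l' hl'))
        rw [dist_eq_norm]
        exact PiLp.norm_apply_le (WithLp.toLp 2 (fun i => f (p l i)) -
          WithLp.toLp 2 fun i => f (p l' i) : EuclideanSpace ℝ (Fin n)) s
    have hnorm : ‖p i - p j‖ ≤ n * (K * r) ^ ε⁻¹ :=
      (norm_le_sum_abs _).trans ((Finset.sum_le_sum fun s _ => hcoord s).trans_eq (by simp))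
    calc ‖p i - p j‖ ^ ε ≤ (n * (K * r) ^ ε⁻¹) ^ ε := by gcongr
      _ = n ^ ε * K * r := by
          rw [Real.mul_rpow (by positivity) (by positivity),
            Real.rpow_inv_rpow (by positivity) hε0.ne', mul_assoc]
      _ ≤ (n * A + n ^ ε * K + 1) * r := by
          gcongr
          have : 0 ≤ n * A := by positivity
          linarith

/-- The `ε`-snowflake of `ℝ^n` has Lipschitz dimension exactly `n`: there is a
Lipschitz light map `(ℝ^n, ‖x - y‖^ε) → ℝ^n`, and for `n ≥ 2` there is no Lipschitz
light map `(ℝ^n, ‖x - y‖^ε) → ℝ^(n-1)`. -/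
theorem stmt4 (ε : ℝ) (hε0 : 0 < ε) (hε1 : ε ≤ 1) (n : ℕ) (hn : 1 ≤ n) :
    (∃ C > 0, ∃ f : EuclideanSpace ℝ (Fin n) → EuclideanSpace ℝ (Fin n),
        LipschitzLightWithD (fun x y => ‖x - y‖ ^ ε) dist C f) ∧
    (2 ≤ n → ¬ ∃ C > 0, ∃ f : EuclideanSpace ℝ (Fin n) → EuclideanSpace ℝ (Fin (n - 1)),
        LipschitzLightWithD (fun x y => ‖x - y‖ ^ ε) dist C f) := by
  refine ⟨exists_lipschitzLightWithD_snowflake hε0 hε1, fun _ => ?_⟩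
  rintro ⟨C, hC, f, hf⟩
  obtain ⟨m, rfl⟩ := Nat.exists_eq_add_of_le' hn
  exact not_lipschitzLightWithD_snowflake hε0 hC m f hf
end

section
/- Let E ⊆ ℝ. Then E has Lipschitz dimension 0 (i.e., there exists C > 0 such that for every r > 0, every r-path in E has diameter at most C·r) if and only if E is porous, i.e., there exists c > 0 such that for every x ∈ E and every r > 0 there is a point y ∈ ℝ with B(y, c·r) ⊆ B(x, r) \ E. -/
open Metric Set

/-- A finite sequence in `E` with steps at most `r` that has a term `≤ y` and a term `> y`
crosses `y` in a single step. -/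
lemma exists_crossing_step {E : Set ℝ} {r y : ℝ} {k : ℕ} {p : ℕ → ℝ}
    (hE : ∀ i ≤ k, p i ∈ E) (hp : ∀ i < k, |p i - p (i + 1)| ≤ r) {i j : ℕ}
    (hi : i ≤ k) (hj : j ≤ k) (hiy : p i ≤ y) (hyj : y < p j) :
    ∃ u ∈ E, ∃ v ∈ E, u ≤ y ∧ y < v ∧ v - u ≤ r := by
  by_contra! h
  have step : ∀ m < k, (p m ≤ y ↔ p (m + 1) ≤ y) := by
    intro m hm
    have hr := abs_le.1 (hp m hm)
    constructor
    · intro hle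
      by_contra! hlt
      linarith [h _ (hE m hm.le) _ (hE (m + 1) hm) hle hlt]
    · intro hle
      by_contra! hlt
      linarith [h _ (hE (m + 1) hm) _ (hE m hm.le) hle hlt]
  have const : ∀ m ≤ k, (p 0 ≤ y ↔ p m ≤ y) := by
    intro m
    induction m with
    | zero => simp
    | succ m ih => exact fun hm => (ih (by omega)).trans (step m hm)
  exact hyj.not_ge ((const j hj).1 ((const i hi).2 hiy))

/-- In a porous set of reals, an `r`-path has diameter at most `(2 + 1 / c) * r`. -/
lemma sub_le_of_porous {E : Set ℝ} {c : ℝ} (hc : 0 < c)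
    (h : ∀ x ∈ E, ∀ r > 0, ∃ y : ℝ, ball y (c * r) ⊆ ball x r \ E)
    {r : ℝ} (hr : 0 < r) {k : ℕ} {p : ℕ → ℝ}
    (hE : ∀ i ≤ k, p i ∈ E) (hp : ∀ i < k, |p i - p (i + 1)| ≤ r) {i j : ℕ}
    (hi : i ≤ k) (hj : j ≤ k) : p j - p i ≤ (2 + 1 / c) * r := by
  by_contra! hlt
  have hcr : 0 < 1 / c * r := by positivity
  obtain ⟨x, hx, v, -, hxm, hmv, hvx⟩ := exists_crossing_step (y := (p i + p j) / 2) hE hp hi hj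
    (by linarith) (by linarith)
  set R := (p j - p i) / 2 - r with hR
  have hR' : 1 / c * r < 2 * R := by rw [hR]; linarith
  have hR0 : 0 < R := by linarith
  have hcR : r < 2 * (c * R) := by
    calc r = c * (1 / c * r) := by field_simp
      _ < c * (2 * R) := by gcongr
      _ = 2 * (c * R) := by ring
  obtain ⟨y, hy⟩ := h x hx R hR0
  have hyx := (hy (mem_ball_self (by positivity))).1
  rw [mem_ball, Real.dist_eq, abs_lt] at hyx
  obtain ⟨u, hu, w, hw, huy, hyw, hwu⟩ := exists_crossing_step (y := y) hE hp hi hj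
    (by linarith) (by linarith)
  have far : ∀ z ∈ E, c * R ≤ |z - y| := by
    intro z hz
    by_contra! hzy
    exact (hy (by rwa [mem_ball, Real.dist_eq])).2 hz
  have hu' := far u hu
  have hw' := far w hw
  rw [abs_of_nonpos (by linarith)] at hu'
  rw [abs_of_pos (by linarith)] at hw'
  linarith

/-- If all `r`-paths in `E` have diameter at most `C * r`, then `E` has a hole of radius
`r / (2 * (k + 1))` in every `ball x r` as soon as `k > 2 * C + 1`. -/
lemma exists_ball_subset_of_path_bound {E : Set ℝ} {C : ℝ}
    (h : ∀ r > 0, ∀ (k : ℕ) (p : ℕ → ℝ), (∀ i ≤ k, p i ∈ E) →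
        (∀ i < k, |p i - p (i + 1)| ≤ r) → ∀ i ≤ k, ∀ j ≤ k, |p i - p j| ≤ C * r)
    {k : ℕ} (hk : 2 * C + 1 < k) (x : ℝ) {r : ℝ} (hr : 0 < r) :
    ∃ y : ℝ, ball y (1 / (2 * (k + 1)) * r) ⊆ ball x r \ E := by
  by_contra! hno
  set s := 1 / (2 * ((k : ℝ) + 1)) * r with hs
  have hs0 : 0 < s := by positivity
  have hrs : r = 2 * (k + 1) * s := by rw [hs]; field_simp
  have near : ∀ i : ℕ, ∃ q, i ≤ k → q ∈ E ∧ |q - (x + s * (2 * i + 1))| < s := by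
    intro i
    by_cases hi : i ≤ k
    swap
    · exact ⟨0, fun h => absurd h hi⟩
    obtain ⟨q, hq, hqn⟩ := not_subset.1 (hno (x + s * (2 * i + 1)))
    rw [mem_ball, Real.dist_eq] at hq
    refine ⟨q, fun _ => ⟨?_, hq⟩⟩
    by_contra hqE
    refine hqn ⟨?_, hqE⟩
    have hik : s * i ≤ s * k := by gcongr
    have his : 0 ≤ s * i := by positivity
    rw [abs_lt] at hq
    rw [mem_ball, Real.dist_eq, abs_lt]
    constructor <;> linarith
  choose p hp using near
  have hdiam := h (4 * s) (by positivity) k p (fun i hi => (hp i hi).1) (by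
    intro i hi
    have h₁ := abs_lt.1 (hp i hi.le).2
    have h₂ := abs_lt.1 (hp (i + 1) hi).2
    push_cast at h₂
    rw [abs_le]
    constructor <;> linarith) k le_rfl 0 (Nat.zero_le k)
  have h₀ := abs_lt.1 (hp 0 (Nat.zero_le k)).2
  have h₁ := abs_lt.1 (hp k le_rfl).2
  push_cast at h₀
  have h₂ := (abs_le.1 hdiam).2
  have h₃ := mul_lt_mul_of_pos_left hk hs0
  linarith

/-- A set `E ⊆ ℝ` has Lipschitz dimension `0` (every `r`-path in `E` has diameter at
most `C * r`) if and only if `E` is porous. -/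
theorem stmt6 (E : Set ℝ) :
    (∃ C > 0, ∀ r > 0, ∀ (k : ℕ) (p : ℕ → ℝ), (∀ i ≤ k, p i ∈ E) →
        (∀ i < k, |p i - p (i + 1)| ≤ r) →
        ∀ i ≤ k, ∀ j ≤ k, |p i - p j| ≤ C * r) ↔
    (∃ c > 0, ∀ x ∈ E, ∀ r > 0, ∃ y : ℝ,
        Metric.ball y (c * r) ⊆ Metric.ball x r \ E) := by
  constructor
  · rintro ⟨C, -, h⟩
    obtain ⟨k, hk⟩ := exists_nat_gt (2 * C + 1)
    exact ⟨1 / (2 * (k + 1)), by positivity,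
      fun x _ r hr => exists_ball_subset_of_path_bound h hk x hr⟩
  · rintro ⟨c, hc, h⟩
    refine ⟨2 + 1 / c, by positivity, fun r hr k p hE hp i hi j hj => abs_sub_le_iff.2 ⟨?_, ?_⟩⟩
    · exact sub_le_of_porous hc h hr hE hp hj hi
    · exact sub_le_of_porous hc h hr hE hp hi hj
end

section
/- Let f : X → Y be a Lipschitz light map between metric spaces, and suppose Y has Nagata dimension at most n, i.e., there exists c > 0 such that for every s > 0 there is a cover of Y by sets each of diameter at most c·s with s-multiplicity at most n + 1. Then X has Nagata dimension at most n: there exists c' > 0 such that for every s > 0 there is a cover of X by sets each of diameter at most c'·s with s-multiplicity at most n + 1. -/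
open Metric Set

/-- A metric space `X` has Nagata dimension at most `n`: there is `c > 0` such that for
every `s > 0` there is a cover of `X` by sets of diameter at most `c * s` such that every
subset of `X` of diameter at most `s` meets at most `n + 1` members of the cover. -/
def NagataDimLE (X : Type*) [PseudoMetricSpace X] (n : ℕ) : Prop :=
  ∃ c > 0, ∀ s > 0, ∃ 𝒰 : Set (Set X),
    (∀ x : X, ∃ U ∈ 𝒰, x ∈ U) ∧
    (∀ U ∈ 𝒰, ∀ x ∈ U, ∀ y ∈ U, dist x y ≤ c * s) ∧
    (∀ E : Set X, (∀ x ∈ E, ∀ y ∈ E, dist x y ≤ s) →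
      {U : Set X | U ∈ 𝒰 ∧ (U ∩ E).Nonempty}.encard ≤ (n + 1 : ℕ∞))

/-- A single step of an `s`-path inside `A`. -/
def PathStep {X : Type*} [PseudoMetricSpace X] (s : ℝ) (A : Set X) (a b : X) : Prop :=
  a ∈ A ∧ b ∈ A ∧ dist a b ≤ s

/-- The `s`-component of `x` in `A`: all points reachable from `x` by an `s`-path inside `A`. -/
def pathComp {X : Type*} [PseudoMetricSpace X] (s : ℝ) (A : Set X) (x : X) : Set X :=
  {y | Relation.ReflTransGen (PathStep s A) x y}

section

variable {X : Type*} [PseudoMetricSpace X] {s : ℝ} {A : Set X} {x y : X}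

theorem PathStep.symm (h : PathStep s A x y) : PathStep s A y x :=
  ⟨h.2.1, h.1, dist_comm x y ▸ h.2.2⟩

theorem reflTransGen_pathStep_symm (h : Relation.ReflTransGen (PathStep s A) x y) :
    Relation.ReflTransGen (PathStep s A) y x := by
  induction h with
  | refl => exact .refl
  | tail _ hbc ih => exact .head hbc.symm ih

theorem pathComp_subset (hx : x ∈ A) : pathComp s A x ⊆ A := by
  intro y hy
  cases hy with
  | refl => exact hx
  | tail _ h => exact h.2.1

theorem pathComp_eq_of_mem (h : y ∈ pathComp s A x) : pathComp s A x = pathComp s A y :=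
  Set.ext fun _ => ⟨(reflTransGen_pathStep_symm h).trans, Relation.ReflTransGen.trans h⟩

theorem exists_path_of_mem_pathComp (hx : x ∈ A) (h : y ∈ pathComp s A x) :
    ∃ (k : ℕ) (p : ℕ → X), p 0 = x ∧ p k = y ∧ (∀ i ≤ k, p i ∈ A) ∧
      ∀ i < k, dist (p i) (p (i + 1)) ≤ s := by
  induction h with
  | refl => exact ⟨0, fun _ => x, rfl, rfl, fun _ _ => hx, by simp⟩
  | @tail b c _ hbc ih =>
    obtain ⟨k, p, h0, hk, hA, hd⟩ := ih
    refine ⟨k + 1, fun i => if i ≤ k then p i else c, by simp [h0], by simp, ?_, ?_⟩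
    · intro i _
      dsimp only
      split_ifs with h
      · exact hA i h
      · exact hbc.2.1
    · intro i hi
      rcases (Nat.lt_succ_iff.mp hi).lt_or_eq with h | rfl
      · simpa [h.le, Nat.succ_le_of_lt h] using hd i h
      · simpa [hk] using hbc.2.2

theorem LipschitzLightWith.dist_le_of_mem_pathComp {Y : Type*} [PseudoMetricSpace Y] {C r : ℝ}
    {f : X → Y} (hf : LipschitzLightWith C f) (hr : 0 < r) (hsr : s ≤ r) {W : Set Y}
    (hW : ∀ w ∈ W, ∀ w' ∈ W, dist w w' ≤ r) (hx : f x ∈ W)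
    (hy : y ∈ pathComp s (f ⁻¹' W) x) : dist x y ≤ C * r := by
  obtain ⟨k, p, rfl, rfl, hA, hd⟩ := exists_path_of_mem_pathComp (A := f ⁻¹' W) hx hy
  exact hf.2 r hr W hW k p hA (fun i hi => (hd i hi).trans hsr) 0 k.zero_le k le_rfl

end

/-- Lipschitz light maps do not increase Nagata dimension: if `f : X → Y` is Lipschitz
light and `Y` has Nagata dimension at most `n`, then so does `X`. -/
theorem stmt8 {X Y : Type*} [MetricSpace X] [MetricSpace Y] (n : ℕ)
    (f : X → Y) (hf : LipschitzLight f) (hY : NagataDimLE Y n) :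
    NagataDimLE X n := by
  obtain ⟨C, hC, hf⟩ := hf
  obtain ⟨c, -, hY⟩ := hY
  have hm : 0 < max 1 (c * C) := lt_max_of_lt_left one_pos
  refine ⟨C * max 1 (c * C), mul_pos hC hm, fun s hs => ?_⟩
  obtain ⟨𝒱, hcov, hdiam, hmult⟩ := hY (C * s) (mul_pos hC hs)
  refine ⟨{U | ∃ V ∈ 𝒱, ∃ x, f x ∈ V ∧ U = pathComp s (f ⁻¹' V) x}, fun x => ?_, ?_, ?_⟩
  · obtain ⟨V, hV, hx⟩ := hcov (f x)
    exact ⟨_, ⟨V, hV, x, hx, rfl⟩, .refl⟩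
  · rintro _ ⟨V, hV, z, hz, rfl⟩ x hx y hy
    rw [mul_assoc]
    refine hf.dist_le_of_mem_pathComp (s := s) (mul_pos hm hs) ?_ (fun w hw w' hw' => ?_)
      (pathComp_subset (A := f ⁻¹' V) hz hx) (pathComp_eq_of_mem hx ▸ hy)
    · exact le_mul_of_one_le_left hs.le (le_max_left _ _)
    · calc dist w w' ≤ c * (C * s) := hdiam V hV w hw w' hw'
        _ = c * C * s := (mul_assoc _ _ _).symm
        _ ≤ _ := mul_le_mul_of_nonneg_right (le_max_right _ _) hs.le
  · intro E hE
    have hfE : ∀ y ∈ f '' E, ∀ y' ∈ f '' E, dist y y' ≤ C * s := by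
      rintro _ ⟨x, hx, rfl⟩ _ ⟨x', hx', rfl⟩
      exact (hf.1 x x').trans (mul_le_mul_of_nonneg_left (hE x hx x' hx') hC.le)
    refine le_trans (Set.encard_le_encard ?_) ((Set.encard_image_le
      (fun V => ⋃ e ∈ E ∩ f ⁻¹' V, pathComp s (f ⁻¹' V) e) _).trans (hmult (f '' E) hfE))
    rintro _ ⟨⟨V, hV, x, hx, rfl⟩, e, hex, heE⟩
    have heV : e ∈ f ⁻¹' V := pathComp_subset (A := f ⁻¹' V) hx hex
    refine ⟨V, ⟨hV, f e, heV, e, heE, rfl⟩, ?_⟩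
    rw [pathComp_eq_of_mem hex]
    refine (Set.iUnion₂_subset fun e' he' => ?_).antisymm
      (Set.subset_biUnion_of_mem (u := fun e => pathComp s (f ⁻¹' V) e) ⟨heE, heV⟩)
    exact (pathComp_eq_of_mem (.single ⟨heV, he'.2, hE e heE e' he'.1⟩)).ge
end

section
/- Let X be a metric space and n a natural number. If there exists a Lipschitz light map f : X → ℝ^n, then X has Nagata dimension at most n: there exists c > 0 such that for every s > 0 there is a cover of X by sets each of diameter at most c·s with s-multiplicity at most n + 1. -/
open Metric Set

/-- Integers at distance at most one, neither of which has the largest residue modulo `N`,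
have the same quotient by `N`. -/
lemma Int.ediv_eq_ediv_of_abs_sub_le_one {N a b : ℤ} (hN : 0 < N) (ha : a % N ≠ N - 1)
    (hb : b % N ≠ N - 1) (h : |a - b| ≤ 1) : a / N = b / N := by
  have key : ∀ c : ℤ, c % N ≠ N - 1 → (c + 1) / N = c / N := by
    intro c hc
    have h0 := Int.emod_nonneg c hN.ne'
    have h1 := Int.emod_lt_of_pos c hN
    have h2 := Int.emod_add_mul_ediv c N
    rw [Int.ediv_eq_iff_of_pos hN]
    constructor
    · linarith
    · have : c % N + 1 < N := by omega
      linarith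
  rw [abs_le] at h
  obtain h | h | h : a = b ∨ a = b + 1 ∨ b = a + 1 := by omega
  · rw [h]
  · rw [h, key b hb]
  · rw [h, key a ha]

lemma EuclideanSpace.dist_le_card_mul {n : ℕ} {x y : EuclideanSpace ℝ (Fin n)} {b : ℝ}
    (hb : 0 ≤ b) (h : ∀ i, |x i - y i| ≤ b) : dist x y ≤ n * b := by
  rw [EuclideanSpace.dist_eq]
  apply Real.sqrt_le_iff.2 ⟨by positivity, ?_⟩
  calc ∑ i, dist (x i) (y i) ^ 2 ≤ ∑ _i : Fin n, b ^ 2 := by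
        refine Finset.sum_le_sum fun i _ => ?_
        rw [Real.dist_eq]
        exact pow_le_pow_left₀ (abs_nonneg _) (h i) 2
    _ = n * b ^ 2 := by simp
    _ ≤ (n : ℝ) ^ 2 * b ^ 2 := by
        gcongr
        exact_mod_cast Nat.le_self_pow two_ne_zero n
    _ = (n * b) ^ 2 := by ring

lemma Int.abs_floor_sub_floor_le_one {u v : ℝ} (h : |u - v| ≤ 1) : |⌊u⌋ - ⌊v⌋| ≤ 1 := by
  rw [abs_le] at h ⊢
  have h1 : ⌊u⌋ ≤ ⌊v + 1⌋ := Int.floor_le_floor (by linarith)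
  have h2 : ⌊v⌋ ≤ ⌊u + 1⌋ := Int.floor_le_floor (by linarith)
  rw [Int.floor_add_one] at h1 h2
  omega

/-- Euclidean `n`-space is covered by `n + 1` sets, each of which splits into uniformly bounded
cells that are pairwise at distance more than `a`. -/
lemma EuclideanSpace.exists_colored_cover (n : ℕ) {a : ℝ} (ha : 0 < a) :
    ∃ (good : Fin (n + 1) → Set (EuclideanSpace ℝ (Fin n)))
      (cell : Fin (n + 1) → EuclideanSpace ℝ (Fin n) → Fin n → ℤ),
      (∀ x, ∃ k, x ∈ good k) ∧
      (∀ k, ∀ x ∈ good k, ∀ y ∈ good k, dist x y ≤ a → cell k x = cell k y) ∧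
      (∀ k x y, cell k x = cell k y → dist x y ≤ n * ((n + 1) * a)) := by
  have hN : (0 : ℤ) < n + 1 := by positivity
  refine ⟨fun k => {x | ∀ i, (⌊x i / a⌋ - (k : ℕ)) % ((n : ℤ) + 1) ≠ n},
    fun k x i => (⌊x i / a⌋ - (k : ℕ)) / ((n : ℤ) + 1), ?_, ?_, ?_⟩
  · intro x
    by_contra! hbad
    simp only [mem_ofPred_eq, not_forall, not_not] at hbad
    choose i hi using hbad
    obtain ⟨k, l, hkl, hil⟩ := Fintype.exists_ne_map_eq_of_card_lt i (by simp)
    apply hkl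
    have hk := hi k
    rw [hil] at hk
    have hdvd := Int.ModEq.dvd (n := n + 1) (hk.trans (hi l).symm)
    have hzero := Int.eq_zero_of_abs_lt_dvd hdvd (by
      have := k.is_lt
      have := l.is_lt
      rw [abs_lt]
      omega)
    ext
    omega
  · intro k x hx y hy hxy
    funext i
    refine Int.ediv_eq_ediv_of_abs_sub_le_one hN (by simpa using hx i) (by simpa using hy i) ?_
    rw [sub_sub_sub_cancel_right]
    apply Int.abs_floor_sub_floor_le_one
    rw [← sub_div, abs_div, abs_of_pos ha, div_le_one ha]
    have := PiLp.norm_apply_le (x - y) i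
    rw [← dist_eq_norm] at this
    simpa using this.trans hxy
  · intro k x y hxy
    refine EuclideanSpace.dist_le_card_mul (by positivity) fun i => ?_
    have hi : (⌊x i / a⌋ - (k : ℕ)) / ((n : ℤ) + 1) = (⌊y i / a⌋ - (k : ℕ)) / ((n : ℤ) + 1) :=
      congrFun hxy i
    have key : ∀ u v : ℝ, (⌊u⌋ - (k : ℕ)) / ((n : ℤ) + 1) = (⌊v⌋ - (k : ℕ)) / ((n : ℤ) + 1) →
        u - v ≤ n + 1 := by
      intro u v huv
      have h1 := Int.emod_add_mul_ediv (⌊u⌋ - (k : ℕ)) ((n : ℤ) + 1)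
      have h2 := Int.emod_add_mul_ediv (⌊v⌋ - (k : ℕ)) ((n : ℤ) + 1)
      have h3 := Int.emod_lt_of_pos (⌊u⌋ - (k : ℕ)) hN
      have h4 := Int.emod_nonneg (⌊v⌋ - (k : ℕ)) hN.ne'
      rw [huv] at h1
      have h5 : ⌊u⌋ ≤ ⌊v⌋ + n := by linarith
      have h6 : (⌊u⌋ : ℝ) ≤ ⌊v⌋ + n := by exact_mod_cast h5
      linarith [Int.lt_floor_add_one u, Int.floor_le v]
    have h1 := key _ _ hi
    have h2 := key _ _ hi.symm
    rw [← sub_div, div_le_iff₀ ha] at h1 h2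
    rw [abs_le]
    constructor <;> linarith

/-- A reflexive-transitive chain can be written as a sequence indexed by natural numbers. -/
lemma Relation.ReflTransGen.exists_seq {α : Type*} {R : α → α → Prop} {x y : α}
    (h : Relation.ReflTransGen R x y) :
    ∃ (k : ℕ) (p : ℕ → α), p 0 = x ∧ p k = y ∧ ∀ i < k, R (p i) (p (i + 1)) := by
  induction h with
  | refl => exact ⟨0, fun _ => x, rfl, rfl, by simp⟩
  | @tail b c _ hbc ih =>
    obtain ⟨k, p, h0, hk, hp⟩ := ih
    refine ⟨k + 1, fun i => if i ≤ k then p i else c, by simpa using h0, by simp, ?_⟩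
    intro i hi
    obtain hik | rfl := Nat.lt_succ_iff_lt_or_eq.1 hi
    · simpa [hik.le, Nat.succ_le_of_lt hik] using hp i hik
    · simpa [hk] using hbc

/-- Nagata dimension is bounded above by Lipschitz dimension: if `X` admits a Lipschitz
light map to `ℝ^n`, then `X` has Nagata dimension at most `n`. -/
theorem stmt9 {X : Type*} [MetricSpace X] (n : ℕ)
    (f : X → EuclideanSpace ℝ (Fin n)) (hf : LipschitzLight f) :
    NagataDimLE X n := by
  obtain ⟨C, hC, hLip, hlight⟩ := hf
  refine ⟨C * (n * ((n + 1) * C) + 1), by positivity, fun s hs => ?_⟩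
  obtain ⟨good, cell, hcover, hsep, hdiam⟩ :=
    EuclideanSpace.exists_colored_cover n (mul_pos hC hs)
  let R : Fin (n + 1) → X → X → Prop := fun k x y =>
    f x ∈ good k ∧ f y ∈ good k ∧ cell k (f x) = cell k (f y) ∧ dist x y ≤ s
  have hRsymm : ∀ k, Std.Symm (R k) := fun k =>
    ⟨fun x y ⟨hx, hy, hxy, hd⟩ => ⟨hy, hx, hxy.symm, by rwa [dist_comm]⟩⟩
  have hsymm : ∀ {k x y}, Relation.ReflTransGen (R k) x y → Relation.ReflTransGen (R k) y x :=
    fun {k x y} h => by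
      have := hRsymm k
      exact Std.Symm.symm _ _ h
  have hgood : ∀ {k x y}, f x ∈ good k → Relation.ReflTransGen (R k) x y →
      f y ∈ good k := by
    intro k x y hx h
    induction h with
    | refl => exact hx
    | tail _ h _ => exact h.2.1
  refine ⟨{U | ∃ k x, f x ∈ good k ∧ U = {y | Relation.ReflTransGen (R k) x y}}, ?_, ?_, ?_⟩
  · intro x
    obtain ⟨k, hk⟩ := hcover (f x)
    exact ⟨_, ⟨k, x, hk, rfl⟩, Relation.ReflTransGen.refl⟩
  · rintro _ ⟨k, x, -, rfl⟩ y hy z hz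
    obtain ⟨m, p, rfl, rfl, hp⟩ := ((hsymm hy).trans hz).exists_seq
    rw [mul_assoc]
    have hr : n * ((n + 1) * (C * s)) ≤ (n * ((n + 1) * C) + 1) * s := by linarith
    have hsr : s ≤ (n * ((n + 1) * C) + 1) * s :=
      le_mul_of_one_le_left hs.le (le_add_of_nonneg_left (by positivity))
    refine hlight _ (by positivity) {w | cell k w = cell k (f (p 0))}
      (fun w hw w' hw' => (hdiam k w w' (hw.trans hw'.symm)).trans hr) m p ?_
      (fun i hi => (hp i hi).2.2.2.trans hsr) 0 (Nat.zero_le _) m le_rfl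
    intro i
    induction i with
    | zero => exact fun _ => rfl
    | succ i ih => exact fun hi => (hp i hi).2.2.1.symm.trans (ih (Nat.le_of_succ_le hi))
  · intro E hE
    have hcolor : ∀ U : Set X, ∃ k : Fin (n + 1),
        (∃ k x, f x ∈ good k ∧ U = {y | Relation.ReflTransGen (R k) x y}) →
          ∃ x, f x ∈ good k ∧ U = {y | Relation.ReflTransGen (R k) x y} := by
      intro U
      by_cases h : ∃ k x, f x ∈ good k ∧ U = {y | Relation.ReflTransGen (R k) x y}
      · exact h.imp fun k hk _ => hk
      · exact ⟨0, fun h' => absurd h' h⟩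
    choose color hcolor using hcolor
    refine (Set.encard_le_encard_of_injOn (t := Set.univ) (f := color)
      (fun _ _ => mem_univ _) ?_).trans (by simp [Set.encard_univ])
    rintro U ⟨hU, y, hyU, hyE⟩ V ⟨hV, z, hzV, hzE⟩ hUV
    obtain ⟨x, hx, hUx⟩ := hcolor U hU
    obtain ⟨x', hx', hVx⟩ := hcolor V hV
    rw [← hUV] at hx' hVx
    rw [hUx] at hyU
    rw [hVx] at hzV
    have hd := hE y hyE z hzE
    have hyz : R (color U) y z := by
      have hy := hgood hx hyU
      have hz := hgood hx' hzV
      refine ⟨hy, hz, hsep _ _ hy _ hz ((hLip y z).trans ?_), hd⟩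
      gcongr
    have hxx' : Relation.ReflTransGen (R (color U)) x x' :=
      (hyU.tail hyz).trans (hsymm hzV)
    rw [hUx, hVx]
    ext w
    exact ⟨fun h => (hsymm hxx').trans h, fun h => hxx'.trans h⟩
end

section
/- Let X be a metric space of Nagata dimension 0, i.e., there exists c > 0 such that for every s > 0 there is a cover of X by sets each of diameter at most c·s with s-multiplicity at most 1. Then every Lipschitz map f : X → Y into any metric space Y is Lipschitz light. -/
open Metric Set

/-- If `X` has Nagata dimension `0`, then every Lipschitz map from `X` into any metric
space is Lipschitz light. -/
theorem stmt11 {X Y : Type*} [MetricSpace X] [MetricSpace Y]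
    (hX : NagataDimLE X 0) (f : X → Y) (L : ℝ)
    (hf : ∀ x x', dist (f x) (f x') ≤ L * dist x x') :
    LipschitzLight f := by
  obtain ⟨c, hc, h⟩ := hX
  refine ⟨max L c, lt_max_of_lt_right hc, fun x x' => (hf x x').trans ?_, ?_⟩
  · gcongr
    exact le_max_left L c
  intro r hr W _ k p _ hp i hi j hj
  obtain ⟨𝒰, hcov, hdiam, hmul⟩ := h r hr
  obtain ⟨U, hU, h0⟩ := hcov (p 0)
  have hmem : ∀ n ≤ k, p n ∈ U := by
    intro n
    induction n with
    | zero => exact fun _ => h0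
    | succ n ih =>
      intro hn
      have hpn := ih (by omega)
      obtain ⟨V, hV, hpV⟩ := hcov (p (n + 1))
      have hstep := hp n (by omega)
      have hcard := hmul {p n, p (n + 1)} (by
        rintro x (rfl | rfl) y (rfl | rfl)
        · simpa using hr.le
        · exact hstep
        · rwa [dist_comm]
        · simpa using hr.le)
      rw [Nat.cast_zero, zero_add, Set.encard_le_one_iff] at hcard
      have hUV : U = V := hcard U V
        ⟨hU, p n, hpn, Or.inl rfl⟩ ⟨hV, p (n + 1), hpV, Or.inr rfl⟩
      exact hUV ▸ hpV
  calc dist (p i) (p j) ≤ c * r := hdiam U hU _ (hmem i hi) _ (hmem j hj)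
    _ ≤ max L c * r := by
      gcongr
      exact le_max_right L c
end

section
/- Let Y be a non-empty compact, doubling metric space. Then there exist a compact metric space X of Nagata dimension 0 (i.e., there is c > 0 such that for every s > 0 there is a cover of X by sets each of diameter at most c·s with s-multiplicity at most 1) and a Lipschitz map from X onto Y. -/
open Metric Set

/-- `X` (compact, of Nagata dimension `0`) admits a Lipschitz surjection onto `Y`. -/
def IsZeroNagataLipschitzCover (Y : Type*) [MetricSpace Y]
    (X : Type*) [MetricSpace X] : Prop :=
  CompactSpace X ∧ NagataDimLE X 0 ∧
    ∃ f : X → Y, (∃ L : ℝ, ∀ a b : X, dist (f a) (f b) ≤ L * dist a b) ∧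
      Function.Surjective f

/-- An ultrametric space has Nagata dimension `0`, as its closed balls of a given radius
form a partition. -/
theorem nagataDimLE_zero_of_isUltrametricDist (X : Type*) [PseudoMetricSpace X]
    [IsUltrametricDist X] : NagataDimLE X 0 := by
  refine ⟨1, one_pos, fun s hs => ⟨range fun x : X => closedBall x s, ?_, ?_, ?_⟩⟩
  · exact fun x => ⟨closedBall x s, ⟨x, rfl⟩, mem_closedBall_self hs.le⟩
  · rintro _ ⟨z, rfl⟩ x hx y hy
    rw [one_mul]
    rw [mem_closedBall'] at hy
    exact (dist_triangle_max x z y).trans (max_le hx hy)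
  · intro E hE
    rw [Nat.cast_zero, zero_add, Set.encard_le_one_iff]
    rintro _ _ ⟨⟨a, rfl⟩, x, hxa, hxE⟩ ⟨⟨b, rfl⟩, y, hyb, hyE⟩
    have hxy : x ∈ closedBall y s := hE x hxE y hyE
    change closedBall a s = closedBall b s
    rw [IsUltrametricDist.closedBall_eq_of_mem hxa, IsUltrametricDist.closedBall_eq_of_mem hyb,
      IsUltrametricDist.closedBall_eq_of_mem hxy]

/-- Every compact metric space is the Lipschitz image of a compact ultrametric space: the space
of sequences in successive finite nets which approximate some point. -/
theorem exists_isZeroNagataLipschitzCover (Y : Type u) [MetricSpace Y] [CompactSpace Y] :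
    ∃ (X : Type u) (m : MetricSpace X), @IsZeroNagataLipschitzCover Y _ X m := by
  have hnet (n : ℕ) : ∃ t : Set Y, t.Finite ∧ ∀ y : Y, ∃ z ∈ t, dist z y ≤ (1 / 2 : ℝ) ^ n := by
    obtain ⟨t, -, ht, hcov⟩ := finite_cover_balls_of_compact (isCompact_univ (X := Y))
      (show (0 : ℝ) < (1 / 2) ^ n by positivity)
    refine ⟨t, ht, fun y => ?_⟩
    obtain ⟨z, hz, hy⟩ := mem_iUnion₂.1 (hcov (mem_univ y))
    exact ⟨z, hz, (mem_ball'.1 hy).le⟩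
  choose t ht hcov using hnet
  have hfin (n : ℕ) : Finite (t n) := ht n
  let : MetricSpace (∀ n, t n) := PiNat.metricSpace
  have : IsUltrametricDist (∀ n, t n) := ⟨PiNat.dist_triangle_nonarch⟩
  let S : Set (∀ n, t n) := {x | ∃ y : Y, ∀ n, dist (x n : Y) y ≤ (1 / 2 : ℝ) ^ n}
  have hS : IsCompact S := by
    have hclosed : IsClosed
        {p : (∀ n, t n) × Y | ∀ n, dist (p.1 n : Y) p.2 ≤ (1 / 2 : ℝ) ^ n} := by
      simp only [ofPred_forall]
      exact isClosed_iInter fun n => isClosed_le (by fun_prop) continuous_const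
    convert hclosed.isCompact.image continuous_fst
    ext x
    simp [S]
  choose f hf using fun x : S => x.2
  refine ⟨S, inferInstance, isCompact_iff_compactSpace.1 hS,
    nagataDimLE_zero_of_isUltrametricDist S, f, ⟨4 + diam (univ : Set Y), fun a b => ?_⟩,
    fun y => ?_⟩
  · have hd : 0 ≤ diam (univ : Set Y) := diam_nonneg
    rcases eq_or_ne a b with rfl | hab
    · simp
    have hab' : a.1 ≠ b.1 := fun h => hab (Subtype.ext h)
    have hdist : dist a b = (1 / 2 : ℝ) ^ PiNat.firstDiff a.1 b.1 := PiNat.dist_eq_of_ne hab'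
    rw [hdist]
    rcases hn : PiNat.firstDiff a.1 b.1 with _ | n
    · have := dist_le_diam_of_mem isCompact_univ.isBounded (mem_univ (f a)) (mem_univ (f b))
      rw [pow_zero]
      linarith
    · have hagree : a.1 n = b.1 n := PiNat.apply_eq_of_lt_firstDiff (by omega)
      have ha := hf a n
      rw [hagree] at ha
      have htri := dist_triangle_left (f a) (f b) (b.1 n : Y)
      have hb := hf b n
      have hpow : (0 : ℝ) < (1 / 2) ^ n := by positivity
      rw [pow_succ]
      nlinarith
  · choose x hxt hx using fun n => hcov n y
    let p : S := ⟨fun n => ⟨x n, hxt n⟩, y, hx⟩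
    refine ⟨p, dist_le_zero.1 (ge_of_tendsto' (x := Filter.atTop)
      (f := fun n : ℕ => 2 * (1 / 2 : ℝ) ^ n) ?_ fun n => ?_)⟩
    · simpa using (tendsto_pow_atTop_nhds_zero_of_lt_one (r := (1 / 2 : ℝ))
        (by norm_num) (by norm_num)).const_mul 2
    · have h := hf p n
      have htri := dist_triangle_left (f p) y (x n)
      change dist (x n) (f p) ≤ _ at h
      linarith [hx n]

/-- Every non-empty compact doubling metric space is the Lipschitz image of a compact
metric space of Nagata dimension `0`. -/
theorem stmt12 {Y : Type u} [MetricSpace Y] [Nonempty Y] [CompactSpace Y]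
    (N : ℕ)
    (hdoub : ∀ (y : Y) (r : ℝ), ∃ t : Finset Y, t.card ≤ N ∧
      Metric.closedBall y r ⊆ ⋃ z ∈ t, Metric.closedBall z (r / 2)) :
    ∃ (X : Type u) (m : MetricSpace X), @IsZeroNagataLipschitzCover Y _ X m := by
  exact exists_isZeroNagataLipschitzCover Y
end

section
/- Let Y be a non-empty compact, doubling metric space. Then there exist a compact metric space X of Lipschitz dimension 0 (i.e., there is C > 0 such that for every r > 0 every r-path in X has diameter at most C·r) and a surjective Lipschitz light map from X onto Y. -/
open Metric Set

/-- `X` (compact, of Lipschitz dimension `0`) admits a surjective Lipschitz light map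
onto `Y`. -/
def IsZeroLipDimLightCover (Y : Type*) [MetricSpace Y]
    (X : Type*) [MetricSpace X] : Prop :=
  CompactSpace X ∧
  (∃ C > 0, ∀ r > 0, ∀ (k : ℕ) (p : ℕ → X),
      (∀ i < k, dist (p i) (p (i + 1)) ≤ r) →
      ∀ i ≤ k, ∀ j ≤ k, dist (p i) (p j) ≤ C * r) ∧
  ∃ f : X → Y, LipschitzLight f ∧ Function.Surjective f

/-- In an ultrametric space every `r`-path has diameter at most `r`. -/
theorem IsUltrametricDist.dist_le_of_path {X : Type*} [PseudoMetricSpace X]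
    [IsUltrametricDist X] {r : ℝ} (hr : 0 ≤ r) {k : ℕ} {p : ℕ → X}
    (hp : ∀ i < k, dist (p i) (p (i + 1)) ≤ r) {i j : ℕ} (hi : i ≤ k) (hj : j ≤ k) :
    dist (p i) (p j) ≤ r := by
  have h0 : ∀ i ≤ k, dist (p 0) (p i) ≤ r := by
    intro i hi
    induction i with
    | zero => simpa using hr
    | succ i ih =>
      exact (dist_triangle_max _ (p i) _).trans (max_le (ih (by omega)) (hp i (by omega)))
  refine (dist_triangle_max _ (p 0) _).trans (max_le ?_ (h0 j hj))
  rw [dist_comm]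
  exact h0 i hi

/-- Every compact metric space is a Lipschitz image of a compact ultrametric space. -/
theorem exists_compact_ultrametric_lipschitz_surjective (Y : Type u) [MetricSpace Y]
    [CompactSpace Y] :
    ∃ (X : Type u) (_ : MetricSpace X), CompactSpace X ∧ IsUltrametricDist X ∧
      ∃ (K : ℝ) (f : X → Y), (∀ x x', dist (f x) (f x') ≤ K * dist x x') ∧
        Function.Surjective f := by
  have hnet : ∀ n : ℕ, ∃ t : Set Y, t.Finite ∧ ∀ y, ∃ z ∈ t, dist z y ≤ (1 / 2 : ℝ) ^ n := by
    intro n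
    obtain ⟨t, -, hfin, ht⟩ := finite_cover_balls_of_compact (X := Y) isCompact_univ
      (show (0 : ℝ) < (1 / 2) ^ n by positivity)
    refine ⟨t, hfin, fun y => ?_⟩
    obtain ⟨z, hz, hy⟩ := mem_iUnion₂.1 (ht (mem_univ y))
    exact ⟨z, hz, (dist_comm z y).trans_le (mem_ball.1 hy).le⟩
  choose t htfin ht using hnet
  have (n : ℕ) : Finite (t n) := htfin n
  let G : Set ((∀ n, t n) × Y) := {q | ∀ n, dist (q.1 n : Y) q.2 ≤ (1 / 2 : ℝ) ^ n}
  have hG : IsClosed G := by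
    simp only [G, ofPred_forall]
    exact isClosed_iInter fun n => isClosed_le (by fun_prop) continuous_const
  let S : Set (∀ n, t n) := Prod.fst '' G
  have hS : IsCompact S := hG.isCompact.image continuous_fst
  have hlim : ∀ x : S, ∃ y : Y, ∀ n, dist (x.1 n : Y) y ≤ (1 / 2 : ℝ) ^ n := by
    rintro ⟨_, q, hq, rfl⟩
    exact ⟨q.2, hq⟩
  choose f hf using hlim
  let _ : MetricSpace (∀ n, t n) := PiNat.metricSpace
  refine ⟨S, inferInstance, isCompact_iff_compactSpace.1 hS,
    ⟨fun x y z => PiNat.dist_triangle_nonarch x.1 y.1 z.1⟩, diam (univ : Set Y) + 4, f, ?_, ?_⟩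
  · intro x x'
    have hD : 0 ≤ diam (univ : Set Y) := diam_nonneg
    rcases eq_or_ne x x' with rfl | hne
    · simp
    rw [Subtype.dist_eq, PiNat.dist_eq_of_ne (Subtype.coe_ne_coe.2 hne)]
    rcases h : PiNat.firstDiff x.1 x'.1 with _ | n
    · have := dist_le_diam_of_mem (isCompact_univ (X := Y)).isBounded
        (mem_univ (f x)) (mem_univ (f x'))
      rw [pow_zero]
      linarith
    · have hx := hf x n
      have hx' := hf x' n
      rw [← PiNat.apply_eq_of_lt_firstDiff (x := x.1) (y := x'.1) (by omega)] at hx'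
      have htri := dist_triangle_left (f x) (f x') (x.1 n : Y)
      have hpos : (0 : ℝ) ≤ diam (univ : Set Y) * (1 / 2) ^ n := by positivity
      rw [pow_succ]
      linarith
  · intro y
    choose z hz hzy using fun n => ht n y
    let x : S := ⟨fun n => ⟨z n, hz n⟩, (⟨fun n => ⟨z n, hz n⟩, y⟩ : (∀ n, t n) × Y), hzy, rfl⟩
    have hlim : Filter.Tendsto (fun n : ℕ => (1 / 2 : ℝ) ^ n) Filter.atTop (nhds 0) :=
      tendsto_pow_atTop_nhds_zero_of_lt_one (by norm_num) (by norm_num)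
    have h1 : Filter.Tendsto z Filter.atTop (nhds (f x)) :=
      tendsto_iff_dist_tendsto_zero.2 (squeeze_zero (fun _ => dist_nonneg) (hf x) hlim)
    have h2 : Filter.Tendsto z Filter.atTop (nhds y) :=
      tendsto_iff_dist_tendsto_zero.2 (squeeze_zero (fun _ => dist_nonneg) hzy hlim)
    exact ⟨x, tendsto_nhds_unique h1 h2⟩

/-- Every non-empty compact doubling metric space is the image of a compact metric space
of Lipschitz dimension `0` under a surjective Lipschitz light map. -/
theorem stmt13 {Y : Type u} [MetricSpace Y] [Nonempty Y] [CompactSpace Y]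
    (N : ℕ)
    (hdoub : ∀ (y : Y) (r : ℝ), ∃ t : Finset Y, t.card ≤ N ∧
      Metric.closedBall y r ⊆ ⋃ z ∈ t, Metric.closedBall z (r / 2)) :
    ∃ (X : Type u) (m : MetricSpace X), @IsZeroLipDimLightCover Y _ X m := by
  obtain ⟨X, m, hc, hu, K, f, hf, hsurj⟩ := exists_compact_ultrametric_lipschitz_surjective Y
  refine ⟨X, m, hc, ⟨1, one_pos, fun r hr k p hp i hi j hj => ?_⟩,
    f, ⟨max K 1, by positivity, fun x x' => ?_, fun r hr W _ k p _ hp i hi j hj => ?_⟩, hsurj⟩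
  · rw [one_mul]
    exact IsUltrametricDist.dist_le_of_path hr.le hp hi hj
  · exact (hf x x').trans (mul_le_mul_of_nonneg_right (le_max_left _ _) dist_nonneg)
  · exact (IsUltrametricDist.dist_le_of_path hr.le hp hi hj).trans
      (le_mul_of_one_le_left hr.le (le_max_right _ _))
end

section
/- Let f : X → Y be a David–Semmes regular map between metric spaces: f is Lipschitz and there is a constant C ≥ 1 such that for every y ∈ Y and r > 0, the preimage f⁻¹(B(y,r)) can be covered by at most C closed balls of radius C·r in X. Then f is Lipschitz light. -/
open Metric Set

/-- An `r`-path covered by finitely many closed balls of radius `R` has endpoints at distance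
at most the number of balls times `2 * R + r`. -/
theorem dist_le_card_mul_of_path_covered {X : Type*} [PseudoMetricSpace X] {p : ℕ → X}
    {r R : ℝ} {j : ℕ} (hr : 0 ≤ r) (hR : 0 ≤ R) (t : Finset X) {i : ℕ} (hij : i ≤ j)
    (hstep : ∀ m, i ≤ m → m < j → dist (p m) (p (m + 1)) ≤ r)
    (hcov : ∀ m, i ≤ m → m ≤ j → ∃ x ∈ t, dist (p m) x ≤ R) :
    dist (p i) (p j) ≤ t.card * (2 * R + r) := by
  classical
  induction t using Finset.strongInduction generalizing i with
  | H t ih =>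
    obtain ⟨x, hx, hix⟩ := hcov i le_rfl hij
    obtain ⟨m, him, hmj, hmx, hmax⟩ : ∃ m, i ≤ m ∧ m ≤ j ∧ dist (p m) x ≤ R ∧
        ∀ n, m < n → n ≤ j → ¬ dist (p n) x ≤ R :=
      ⟨Nat.findGreatest (fun n => dist (p n) x ≤ R) j, Nat.le_findGreatest hij hix,
        Nat.findGreatest_le j, Nat.findGreatest_spec (P := fun n => dist (p n) x ≤ R) hij hix,
        fun n hn hnj => Nat.findGreatest_is_greatest hn hnj⟩
    have him' : dist (p i) (p m) ≤ 2 * R := by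
      linarith [dist_triangle_right (p i) (p m) x]
    have hcard : ((t.erase x).card : ℝ) + 1 = t.card := by
      exact_mod_cast Finset.card_erase_add_one hx
    rw [← hcard]
    rcases hmj.eq_or_lt with rfl | hlt
    · nlinarith [mul_nonneg (Nat.cast_nonneg (α := ℝ) (t.erase x).card)
        (by linarith : 0 ≤ 2 * R + r)]
    · have htail := ih (t.erase x) (Finset.erase_ssubset hx) (i := m + 1) hlt
        (fun n hn hnj => hstep n (by omega) hnj)
        (fun n hn hnj => by
          obtain ⟨y, hy, hny⟩ := hcov n (by omega) hnj
          refine ⟨y, Finset.mem_erase.2 ⟨?_, hy⟩, hny⟩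
          rintro rfl
          exact hmax n hn hnj hny)
      linarith [hstep m him hlt, dist_triangle4 (p i) (p m) (p (m + 1)) (p j)]

/-- David–Semmes regular maps are Lipschitz light. -/
theorem stmt14 {X Y : Type*} [MetricSpace X] [MetricSpace Y] (f : X → Y)
    (L : ℝ) (hlip : ∀ x x', dist (f x) (f x') ≤ L * dist x x')
    (C : ℝ) (hC : 1 ≤ C)
    (hreg : ∀ (y : Y), ∀ r > 0, ∃ t : Finset X, (t.card : ℝ) ≤ C ∧
      f ⁻¹' (Metric.ball y r) ⊆ ⋃ x ∈ t, Metric.closedBall x (C * r)) :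
    LipschitzLight f := by
  refine ⟨max L (C * (4 * C + 1)), lt_max_of_lt_right (by positivity),
    fun x x' => (hlip x x').trans (by gcongr; exact le_max_left _ _), ?_⟩
  intro r hr W hW k p hpW hstep
  obtain ⟨t, htC, hcov⟩ := hreg (f (p 0)) (2 * r) (by linarith)
  have hpath : ∀ i j, i ≤ j → j ≤ k →
      dist (p i) (p j) ≤ max L (C * (4 * C + 1)) * r := fun i j hij hjk => calc
    dist (p i) (p j) ≤ t.card * (2 * (C * (2 * r)) + r) := by
      refine dist_le_card_mul_of_path_covered hr.le (by positivity) t hij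
        (fun m _ hm => hstep m (by omega)) (fun m _ hm => ?_)
      have hmem : p m ∈ f ⁻¹' ball (f (p 0)) (2 * r) := by
        have := hW _ (hpW m (by omega)) _ (hpW 0 (by omega))
        simp only [mem_preimage, mem_ball]
        linarith
      simpa using hcov hmem
    _ ≤ C * (2 * (C * (2 * r)) + r) := by gcongr
    _ = C * (4 * C + 1) * r := by ring
    _ ≤ max L (C * (4 * C + 1)) * r := by gcongr; exact le_max_right _ _
  intro i hi j hj
  rcases le_total i j with hij | hij
  · exact hpath i j hij hj
  · rw [dist_comm]
    exact hpath j i hij hi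
end

section
/- Let X = ℤ × [0,1] carry the sup product metric d((n,t),(m,s)) = max(|n − m|, |t − s|). Then the map f : X → ℝ defined by f(n,t) = 2n + t is bi-Lipschitz: d((n,t),(m,s)) ≤ |f(n,t) − f(m,s)| ≤ 3·d((n,t),(m,s)) for all (n,t),(m,s) ∈ X. In particular, ℤ × [0,1] has Lipschitz dimension 1 even though each factor has Lipschitz dimension 1. -/
open Metric Set

theorem dist_le_abs_two_mul_add_sub (p q : ℤ × (Set.Icc (0 : ℝ) 1)) :
    dist p q ≤ |(2 * (p.1 : ℝ) + (p.2 : ℝ)) - (2 * (q.1 : ℝ) + (q.2 : ℝ))| := by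
  obtain ⟨n, t, ht0, ht1⟩ := p
  obtain ⟨m, s, hs0, hs1⟩ := q
  simp only [Prod.dist_eq, Int.dist_eq, Subtype.dist_eq, Real.dist_eq]
  rcases lt_trichotomy n m with h | rfl | h
  · have h' : (n : ℝ) + 1 ≤ m := by exact_mod_cast h
    refine le_trans (max_le ?_ ?_) (neg_le_abs _)
    all_goals rw [abs_le]; constructor <;> linarith
  · simp
  · have h' : (m : ℝ) + 1 ≤ n := by exact_mod_cast h
    refine le_trans (max_le ?_ ?_) (le_abs_self _)
    all_goals rw [abs_le]; constructor <;> linarith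

theorem abs_two_mul_add_sub_le (p q : ℤ × (Set.Icc (0 : ℝ) 1)) :
    |(2 * (p.1 : ℝ) + (p.2 : ℝ)) - (2 * (q.1 : ℝ) + (q.2 : ℝ))| ≤ 3 * dist p q := by
  have h₁ : |(p.1 : ℝ) - q.1| ≤ dist p q := le_max_left _ _
  have h₂ : |(p.2 : ℝ) - q.2| ≤ dist p q := le_max_right _ _
  rw [abs_le] at h₁ h₂ ⊢
  constructor <;> linarith

/-- A Lipschitz map that does not decrease distances is Lipschitz light. -/
theorem LipschitzLight.of_dist_le {X Y : Type*} [PseudoMetricSpace X] [PseudoMetricSpace Y]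
    {C : ℝ} {f : X → Y} (hC : 1 ≤ C) (hf : ∀ x x', dist (f x) (f x') ≤ C * dist x x')
    (hf' : ∀ x x', dist x x' ≤ dist (f x) (f x')) : LipschitzLight f :=
  ⟨C, one_pos.trans_le hC, hf, fun _ hr _ hW _ p hp _ i hi j hj =>
    ((hf' (p i) (p j)).trans (hW _ (hp i hi) _ (hp j hj))).trans
      (le_mul_of_one_le_left hr.le hC)⟩

/-- The map `f(n, t) = 2n + t` is a bi-Lipschitz embedding of `ℤ × [0,1]` (with the sup
product metric) into `ℝ`; in particular `ℤ × [0,1]` has Lipschitz dimension at most `1`. -/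
theorem stmt16 :
    (∀ p q : ℤ × (Set.Icc (0 : ℝ) 1),
      dist p q ≤ |(2 * (p.1 : ℝ) + (p.2 : ℝ)) - (2 * (q.1 : ℝ) + (q.2 : ℝ))| ∧
      |(2 * (p.1 : ℝ) + (p.2 : ℝ)) - (2 * (q.1 : ℝ) + (q.2 : ℝ))| ≤ 3 * dist p q) ∧
    LipschitzLight (fun p : ℤ × (Set.Icc (0 : ℝ) 1) =>
      (2 * (p.1 : ℝ) + (p.2 : ℝ) : ℝ)) := by
  refine ⟨fun p q => ⟨dist_le_abs_two_mul_add_sub p q, abs_two_mul_add_sub_le p q⟩, ?_⟩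
  exact LipschitzLight.of_dist_le (C := 3) (by norm_num) abs_two_mul_add_sub_le
    dist_le_abs_two_mul_add_sub
end

section
/- Let X = [0,1] × (2ℤ) with the sup product metric, let Y = [0,1], and let f : X → Y be the projection to the first factor, f(t, 2n) = t. Then (a) f satisfies the Cheeger–Kleiner definition of Lipschitz light with constant C = 1: f is 1-Lipschitz and for every non-empty bounded W ⊆ Y, every diam(W)-path contained in f⁻¹(W) has diameter at most diam(W); but (b) f is not Lipschitz light: there is no constant C > 0 such that for every r > 0 and every W ⊆ Y with diam(W) ≤ r, every r-path contained in f⁻¹(W) has diameter at most C·r. -/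
open Metric Set

/-- Distinct even integers are at distance at least `2`. -/
lemma eq_of_dist_lt_two {a b : {x : ℝ | ∃ n : ℤ, x = 2 * n}} (h : dist a b < 2) : a = b := by
  obtain ⟨_, m, rfl⟩ := a
  obtain ⟨_, n, rfl⟩ := b
  rw [Subtype.dist_eq, Real.dist_eq, abs_lt] at h
  have h₁ : n - 1 < m := by
    have : ((n - 1 : ℤ) : ℝ) < m := by push_cast; linarith [h.1]
    exact_mod_cast this
  have h₂ : m < n + 1 := by
    have : (m : ℝ) < ((n + 1 : ℤ) : ℝ) := by push_cast; linarith [h.2]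
    exact_mod_cast this
  obtain rfl : m = n := by lia
  rfl

/-- Every path in `Y × 2ℤ` with steps shorter than `2` has constant second coordinate. -/
lemma snd_eq_of_dist_lt_two {Y : Type*} [PseudoMetricSpace Y] {k : ℕ}
    {p : ℕ → Y × {x : ℝ | ∃ n : ℤ, x = 2 * n}}
    (h : ∀ i < k, dist (p i) (p (i + 1)) < 2) : ∀ i ≤ k, (p i).2 = (p 0).2 := by
  intro i
  induction i with
  | zero => exact fun _ => rfl
  | succ i ih =>
    intro hi
    rw [← ih (by lia)]
    exact (eq_of_dist_lt_two ((le_max_right _ _).trans_lt (h i (by lia)))).symm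

/-- The projection `[0,1] × 2ℤ → [0,1]` satisfies the Cheeger–Kleiner definition of
Lipschitz light with constant `1`, but it is not Lipschitz light in the sense of
Definition 1.2. -/
theorem stmt19 :
    ((∀ p q : (Set.Icc (0 : ℝ) 1) × {x : ℝ | ∃ n : ℤ, x = 2 * n},
        dist (p.1 : Set.Icc (0 : ℝ) 1) (q.1 : Set.Icc (0 : ℝ) 1) ≤ 1 * dist p q) ∧
      ∀ W : Set (Set.Icc (0 : ℝ) 1), W.Nonempty → Bornology.IsBounded W →
        ∀ (k : ℕ) (p : ℕ → (Set.Icc (0 : ℝ) 1) × {x : ℝ | ∃ n : ℤ, x = 2 * n}),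
          (∀ i ≤ k, (p i).1 ∈ W) →
          (∀ i < k, dist (p i) (p (i + 1)) ≤ Metric.diam W) →
          ∀ i ≤ k, ∀ j ≤ k, dist (p i) (p j) ≤ 1 * Metric.diam W) ∧
    ¬ ∃ C > 0, LipschitzLightWith C
        (fun p : (Set.Icc (0 : ℝ) 1) × {x : ℝ | ∃ n : ℤ, x = 2 * n} => p.1) := by
  refine ⟨⟨fun p q => ?_, fun W _ hW k p hpW hp i hi j hj => ?_⟩, ?_⟩
  · rw [one_mul]
    exact le_max_left _ _
  · rw [one_mul]
    have hdiam : Metric.diam W ≤ 1 := by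
      refine Metric.diam_le_of_forall_dist_le zero_le_one fun x _ y _ => ?_
      rw [Subtype.dist_eq, Real.dist_eq, abs_le]
      constructor <;> linarith [x.2.1, x.2.2, y.2.1, y.2.2]
    have hsnd := snd_eq_of_dist_lt_two (k := k) (p := p)
      fun i hi => (hp i hi).trans_lt (by linarith)
    rw [Prod.dist_eq, hsnd i hi, hsnd j hj, dist_self]
    exact max_le (Metric.dist_le_diam_of_mem hW (hpW i hi) (hpW j hj)) Metric.diam_nonneg
  · rintro ⟨C, -, -, h⟩
    obtain ⟨k, hk⟩ := exists_nat_gt C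
    have hdist := h 2 two_pos Set.univ
      (fun x _ y _ => by
        rw [Subtype.dist_eq, Real.dist_eq, abs_le]
        constructor <;> linarith [x.2.1, x.2.2, y.2.1, y.2.2])
      k (fun i => (⟨0, by simp⟩, ⟨2 * (i : ℝ), i, by simp⟩)) (fun _ _ => Set.mem_univ _)
      (fun i _ => by
        simp only [Prod.dist_eq, dist_self, Subtype.dist_eq, Real.dist_eq]
        refine max_le zero_le_two (abs_le.2 ?_)
        push_cast
        constructor <;> linarith)
      k le_rfl 0 (Nat.zero_le k)
    have hle := (le_max_right _ _).trans hdist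
    simp only [Subtype.dist_eq, Real.dist_eq] at hle
    have := (le_abs_self _).trans hle
    push_cast at this
    linarith
end
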